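/- arXiv:1501.04193 — 3 statements merged into one kernel-verified Lean document; each statement's English description precedes it below -/
import Mathlib

section
/- Let u, v ∈ ℚ² ∖ ℤ². Then f_u(τ) = f_v(τ) as functions on ℍ if and only if u ≡ ±v (mod ℤ²). -/
noncomputable section

open Complex Matrix UpperHalfPlane MatrixGroups

abbrev SL2Z := Matrix.SpecialLinearGroup (Fin 2) ℤ

/-- `e2pi z = exp(2πiz)`. -/
def e2pi (z : ℂ) : ℂ := Complex.exp (2 * Real.pi * Complex.I * z)

/-- `qpow τ x = q^x = exp(2πixτ)`. -/
def qpow (τ : ℍ) (x : ℂ) : ℂ := Complex.exp (2 * Real.pi * Complex.I * x * τ)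

/-- The lattice point `mτ + n` for `p = (m, n)`. -/
def latticePt (τ : ℍ) (p : ℤ × ℤ) : ℂ := (p.1 : ℂ) * τ + (p.2 : ℂ)

/-- Weierstrass invariant `g₂` of the lattice `[τ, 1]`. -/
def g2fun (τ : ℍ) : ℂ := 60 * ∑' p : {p : ℤ × ℤ // p ≠ 0}, (latticePt τ p.1)⁻¹ ^ 4

/-- Weierstrass invariant `g₃` of the lattice `[τ, 1]`. -/
def g3fun (τ : ℍ) : ℂ := 140 * ∑' p : {p : ℤ × ℤ // p ≠ 0}, (latticePt τ p.1)⁻¹ ^ 6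

/-- The discriminant `Δ = g₂³ - 27g₃²`. -/
def deltaFun (τ : ℍ) : ℂ := g2fun τ ^ 3 - 27 * g3fun τ ^ 2

/-- The elliptic modular function `j = 1728 g₂³/Δ`. -/
def jfun (τ : ℍ) : ℂ := 1728 * g2fun τ ^ 3 / deltaFun τ

/-- The Weierstrass `℘`-function of the lattice `[τ, 1]`. -/
def wpfun (τ : ℍ) (z : ℂ) : ℂ :=
  z⁻¹ ^ 2 + ∑' p : {p : ℤ × ℤ // p ≠ 0},
    ((z - latticePt τ p.1)⁻¹ ^ 2 - (latticePt τ p.1)⁻¹ ^ 2)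

/-- The Fricke function `f_v = -2⁷3⁵ (g₂g₃/Δ) ℘(v₁τ + v₂)`. -/
def fricke (v : ℚ × ℚ) (τ : ℍ) : ℂ :=
  -(2 ^ 7 * 3 ^ 5 : ℂ) * g2fun τ * g3fun τ / deltaFun τ *
    wpfun τ ((v.1 : ℂ) * τ + (v.2 : ℂ))

/-- The Siegel function `g_v`, via its `q`-product expansion. -/
def siegel (v : ℚ × ℚ) (τ : ℍ) : ℂ :=
  -Complex.exp (Real.pi * Complex.I * (v.2 : ℂ) * ((v.1 : ℂ) - 1)) *
    qpow τ (((v.1 : ℂ) ^ 2 - (v.1 : ℂ) + 1 / 6) / 2) *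
    (1 - qpow τ (v.1 : ℂ) * e2pi (v.2 : ℂ)) *
    ∏' n : ℕ,
      ((1 - qpow τ ((n : ℂ) + 1 + (v.1 : ℂ)) * e2pi (v.2 : ℂ)) *
       (1 - qpow τ ((n : ℂ) + 1 - (v.1 : ℂ)) * e2pi (-(v.2 : ℂ))))

/-- Extend a function on `ℍ` to `ℂ` by junk values. -/
def asComplexFun (h : ℍ → ℂ) : ℂ → ℂ :=
  fun z => if hz : 0 < z.im then h ⟨z, hz⟩ else 0

/-- `h` is holomorphic on `ℍ`. -/
def IsHoloOnH (h : ℍ → ℂ) : Prop :=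
  DifferentiableOn ℂ (asComplexFun h) {z : ℂ | 0 < z.im}

/-- `h` is meromorphic on `ℍ`. -/
def IsMeromOnH (h : ℍ → ℂ) : Prop :=
  MeromorphicOn (asComplexFun h) {z : ℂ | 0 < z.im}

/-- `v ∈ V_N`: `v = (a/N, b/N)` with `gcd(a, b, N) = 1`. -/
def InVN (N : ℕ) (v : ℚ × ℚ) : Prop :=
  ∃ a b : ℤ, v.1 = (a : ℚ) / (N : ℚ) ∧ v.2 = (b : ℚ) / (N : ℚ) ∧
    Int.gcd a (Int.gcd b (N : ℤ)) = 1

/-- `v ∈ ℤ²`. -/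
def IsIntPair (v : ℚ × ℚ) : Prop := ∃ m n : ℤ, v.1 = (m : ℚ) ∧ v.2 = (n : ℚ)

/-- `u ≡ v (mod ℤ²)`. -/
def EqModZ2 (u v : ℚ × ℚ) : Prop := IsIntPair (u.1 - v.1, u.2 - v.2)

/-- `u ≡ ±v (mod ℤ²)`. -/
def PMEquiv (u v : ℚ × ℚ) : Prop := EqModZ2 u v ∨ EqModZ2 u (-v.1, -v.2)

/-- The action `v ↦ ᵗγ·v` of a matrix on a rational pair. -/
def tAct (γ : Matrix (Fin 2) (Fin 2) ℤ) (v : ℚ × ℚ) : ℚ × ℚ :=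
  ((γ 0 0 : ℚ) * v.1 + (γ 1 0 : ℚ) * v.2, (γ 0 1 : ℚ) * v.1 + (γ 1 1 : ℚ) * v.2)

/-- `h` agrees, near `i∞`, with the expansion `∑_{n ≥ n₀} σ_d(c_n) q^{n/N}` where the
coefficients `c_n ∈ ℚ(ζ_N)` are recorded as polynomials in `ζ_N` with rational coefficients
and `σ_d(c_n)` is obtained by evaluating at `ζ_N^d`. -/
def QExp (N : ℕ) (c : ℤ → Polynomial ℚ) (n₀ : ℤ) (d : ℤ) (h : ℍ → ℂ) : Prop :=
  ∃ A : ℝ, ∀ τ : ℍ, A < τ.im →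
    h τ = ∑' n : ℕ, (Polynomial.aeval (e2pi ((d : ℂ) / (N : ℂ))) (c (n₀ + (n : ℤ)))) *
      qpow τ (((n₀ + (n : ℤ) : ℤ) : ℂ) / (N : ℂ))

/-- `h` is meromorphic at `i∞`, with a Fourier expansion in powers of `q^{1/N}`. -/
def CuspExp (N : ℕ) (h : ℍ → ℂ) : Prop :=
  ∃ (n₀ : ℤ) (c : ℤ → ℂ) (A : ℝ), ∀ τ : ℍ, A < τ.im →
    h τ = ∑' n : ℕ, c (n₀ + (n : ℤ)) * qpow τ (((n₀ + (n : ℤ) : ℤ) : ℂ) / (N : ℂ))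

/-- `h` has a Fourier expansion in powers of `q^{1/N}` with rational coefficients. -/
def RatQExp (N : ℕ) (h : ℍ → ℂ) : Prop :=
  ∃ (n₀ : ℤ) (c : ℤ → ℚ) (A : ℝ), ∀ τ : ℍ, A < τ.im →
    h τ = ∑' n : ℕ, (c (n₀ + (n : ℤ)) : ℂ) * qpow τ (((n₀ + (n : ℤ) : ℤ) : ℂ) / (N : ℂ))

/-- `γ ∈ Γ(N)`, i.e. `γ ≡ I₂ (mod N)`. -/
def InGammaN (N : ℕ) (γ : SL2Z) : Prop :=
  ((γ 0 0 : ℤ) : ZMod N) = 1 ∧ ((γ 0 1 : ℤ) : ZMod N) = 0 ∧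
  ((γ 1 0 : ℤ) : ZMod N) = 0 ∧ ((γ 1 1 : ℤ) : ZMod N) = 1

/-- `γ ∈ Γ¹(N)`, i.e. `γ ≡ [[1,0],[*,1]] (mod N)`. -/
def InGamma1Lower (N : ℕ) (γ : SL2Z) : Prop :=
  ((γ 0 0 : ℤ) : ZMod N) = 1 ∧ ((γ 0 1 : ℤ) : ZMod N) = 0 ∧ ((γ 1 1 : ℤ) : ZMod N) = 1

/-- `γ ∈ Γ₁(N)`, i.e. `γ ≡ [[1,*],[0,1]] (mod N)`. -/
def InGamma1Upper (N : ℕ) (γ : SL2Z) : Prop :=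
  ((γ 0 0 : ℤ) : ZMod N) = 1 ∧ ((γ 1 0 : ℤ) : ZMod N) = 0 ∧ ((γ 1 1 : ℤ) : ZMod N) = 1

/-- `h ∈ F_N`: meromorphic on `ℍ`, modular for `Γ(N)`, meromorphic at the cusps and
with Fourier coefficients in `ℚ(ζ_N)`. -/
structure MemFN (N : ℕ) (h : ℍ → ℂ) : Prop where
  merom : IsMeromOnH h
  modular : ∀ γ : SL2Z, InGammaN N γ → ∀ τ : ℍ, h (γ • τ) = h τ
  cusp : ∀ γ : SL2Z, CuspExp N (fun τ => h (γ • τ))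
  coeff : ∃ (c : ℤ → Polynomial ℚ) (n₀ : ℤ), QExp N c n₀ 1 h

/-- `h ∈ F¹_N(ℚ)`: meromorphic on `ℍ`, modular for `Γ¹(N)`, meromorphic at the cusps and
with rational Fourier coefficients. -/
structure MemF1N (N : ℕ) (h : ℍ → ℂ) : Prop where
  merom : IsMeromOnH h
  modular : ∀ γ : SL2Z, InGamma1Lower N γ → ∀ τ : ℍ, h (γ • τ) = h τ
  cusp : ∀ γ : SL2Z, CuspExp N (fun τ => h (γ • τ))
  ratQ : RatQExp N h

/-- `h ∈ O¹_N(ℚ)`: the weakly holomorphic elements of `F¹_N(ℚ)`. -/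
def MemO1N (N : ℕ) (h : ℍ → ℂ) : Prop := MemF1N N h ∧ IsHoloOnH h

/-- `β ∈ SL₂(ℤ)` is a lift of `[[1,0],[0,det γ]]⁻¹ · γ (mod N)`, so that
`γ ≡ [[1,0],[0,det γ]] · β (mod N)`. -/
def SLCompat (N : ℕ) (γ : Matrix (Fin 2) (Fin 2) ℤ) (β : SL2Z) : Prop :=
  ((β 0 0 : ℤ) : ZMod N) = ((γ 0 0 : ℤ) : ZMod N) ∧
  ((β 0 1 : ℤ) : ZMod N) = ((γ 0 1 : ℤ) : ZMod N) ∧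
  ((γ.det : ℤ) : ZMod N) * ((β 1 0 : ℤ) : ZMod N) = ((γ 1 0 : ℤ) : ZMod N) ∧
  ((γ.det : ℤ) : ZMod N) * ((β 1 1 : ℤ) : ZMod N) = ((γ 1 1 : ℤ) : ZMod N)

/-- Condition (F3): for every `γ ∈ GL₂(ℤ/Nℤ)`, written as `[[1,0],[0,d]]·β` with
`d = det γ` and `β ∈ SL₂(ℤ/Nℤ)`, one has `h_v^γ = h_{ᵗγ·v}`; here `h_v^γ = (σ_d h_v) ∘ β`
is expressed through `q`-expansions. -/
def GaloisCompat (N : ℕ) (h : (ℚ × ℚ) → ℍ → ℂ) : Prop :=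
  ∀ v : ℚ × ℚ, InVN N v →
    ∀ γ : Matrix (Fin 2) (Fin 2) ℤ, Int.gcd γ.det (N : ℤ) = 1 →
      ∀ β : SL2Z, SLCompat N γ β →
        ∀ (c : ℤ → Polynomial ℚ) (n₀ : ℤ), QExp N c n₀ 1 (h v) →
          QExp N c n₀ γ.det (fun τ => h (tAct γ v) (β⁻¹ • τ))

/-- A Fricke family of level `N`. -/
structure IsFrickeFamily (N : ℕ) (h : (ℚ × ℚ) → ℍ → ℂ) : Prop where
  mem : ∀ v : ℚ × ℚ, InVN N v → MemFN N (h v)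
  holo : ∀ v : ℚ × ℚ, InVN N v → IsHoloOnH (h v)
  pm : ∀ u v : ℚ × ℚ, InVN N u → InVN N v → PMEquiv u v → h u = h v
  galois : GaloisCompat N h

/-- `ζ₃ = e^{2πi/3}` as a point of `ℍ`. -/
def zeta3H : ℍ := ⟨Complex.exp (2 * Real.pi * Complex.I / 3), by
  have h : (2 * Real.pi * Complex.I / 3 : ℂ) = Complex.I * ((2 * Real.pi / 3 : ℝ) : ℂ) := by
    push_cast; ring
  rw [h]
  rw [show Complex.I * ((2 * Real.pi / 3 : ℝ) : ℂ) = (((2 * Real.pi / 3 : ℝ) : ℂ) * Complex.I) by ring]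
  rw [Complex.exp_ofReal_mul_I_im]
  exact Real.sin_pos_of_pos_of_lt_pi (by positivity) (by nlinarith [Real.pi_pos])⟩

/-- `ζ₄ = i` as a point of `ℍ`. -/
def zeta4H : ℍ := ⟨Complex.I, by simp⟩

/-- The set of points of `ℂ` lying in the `SL₂(ℤ)`-orbit of `ζ₃` or `ζ₄`. -/
def exceptionalSet : Set ℂ :=
  {z : ℂ | ∃ γ : SL2Z, z = ((γ • zeta3H : ℍ) : ℂ) ∨ z = ((γ • zeta4H : ℍ) : ℂ)}

/-- `ℍ' = ℍ ∖ {γζ₃, γζ₄ : γ ∈ SL₂(ℤ)}`, as a subset of `ℂ`. -/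
def upperHalfPlaneSlit : Set ℂ := {z : ℂ | 0 < z.im} \ exceptionalSet

/-- `h` is holomorphic on `ℍ'`. -/
def IsHoloOnH' (h : ℍ → ℂ) : Prop :=
  DifferentiableOn ℂ (asComplexFun h) upperHalfPlaneSlit

/-- Multiplication of a point of `ℍ` by `4`. -/
def fourH (τ : ℍ) : ℍ := ⟨4 * (τ : ℂ), by
  have h : (0:ℝ) < (τ : ℂ).im := τ.2
  have h4 : (4 * (τ : ℂ)).im = 4 * (τ : ℂ).im := by
    simp [Complex.mul_im]
  rw [h4]; linarith⟩



open ModularForm EisensteinSeries in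
theorem aux_eis (k : ℕ) (hk : 3 ≤ k) (τ : ℍ) :
    ∑' p : {p : ℤ × ℤ // p ≠ 0}, (latticePt τ p.1)⁻¹ ^ k = 2 * riemannZeta k * E hk τ := by
  have h1 := tsum_eisSummand_eq_riemannZeta_mul_eisensteinSeries hk τ
  have h2 : E hk τ = (1 / 2 : ℂ) * eisensteinSeries (N := 1) 0 k τ := by
    rw [show E hk τ = (1 / 2 : ℂ) • eisensteinSeriesSIF (N := 1) 0 k τ from rfl,
      eisensteinSeriesSIF_apply 0 k τ, smul_eq_mul]
  rw [h2]
  have h3 : ∑' v : Fin 2 → ℤ, eisSummand k v τ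
      = ∑' p : ℤ × ℤ, (latticePt τ p)⁻¹ ^ k := by
    rw [← (finTwoArrowEquiv ℤ).symm.tsum_eq]
    refine tsum_congr fun p => ?_
    simp [eisSummand, latticePt]
  have h4 : ∑' p : {p : ℤ × ℤ // p ≠ 0}, (latticePt τ p.1)⁻¹ ^ k
      = ∑' p : ℤ × ℤ, (latticePt τ p)⁻¹ ^ k := by
    refine tsum_subtype_eq_of_support_subset (f := fun p => (latticePt τ p)⁻¹ ^ k)
      (s := {p : ℤ × ℤ | p ≠ 0}) ?_
    intro p hp h0
    apply hp
    subst h0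
    simp [latticePt, show k ≠ 0 by omega]
  rw [h4, ← h3, h1]
  ring

theorem aux_zeta_six : riemannZeta 6 = (Real.pi : ℂ) ^ 6 / 945 := by
  have := riemannZeta_two_mul_nat (k := 3) (by norm_num)
  rw [show (2 * ((3 : ℕ) : ℂ)) = 6 by norm_num] at this
  rw [this]
  have hb : bernoulli 6 = 1 / 42 := by
    have h5 : bernoulli' 5 = 0 := bernoulli'_eq_zero_of_odd (by decide) (by norm_num)
    rw [bernoulli_eq_bernoulli'_of_ne_one (by norm_num), bernoulli'_def]
    norm_num [Finset.sum_range_succ, Nat.choose, h5]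
  simp [hb, Nat.factorial]
  ring

open ModularForm EisensteinSeries in
theorem aux_g2 (τ : ℍ) : g2fun τ = 4 * (Real.pi : ℂ) ^ 4 / 3 * E₄ τ := by
  rw [g2fun, aux_eis 4 (by norm_num)]
  have := riemannZeta_four
  push_cast
  rw [this]
  ring

open ModularForm EisensteinSeries in
theorem aux_g3 (τ : ℍ) : g3fun τ = 8 * (Real.pi : ℂ) ^ 6 / 27 * E₆ τ := by
  rw [g3fun, aux_eis 6 (by norm_num)]
  have := aux_zeta_six
  push_cast
  rw [this]
  ring

theorem aux_delta_ne (τ : ℍ) : deltaFun τ ≠ 0 := by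
  have h := ModularForm.discriminant_eq_E₄_cube_sub_E₆_sq τ
  have h0 := ModularForm.discriminant_ne_zero τ
  have : deltaFun τ = 64 * (Real.pi : ℂ) ^ 12 / 27 * 1728 * ModularForm.discriminant τ := by
    rw [deltaFun, aux_g2, aux_g3, h]
    ring
  rw [this]
  have hpi : (Real.pi : ℂ) ≠ 0 := by simp [Real.pi_ne_zero]
  refine mul_ne_zero (mul_ne_zero (div_ne_zero (mul_ne_zero ?_ (pow_ne_zero _ hpi)) ?_) ?_) h0 <;>
    norm_num

open ModularForm EisensteinSeries in
theorem aux_E_tendsto {k : ℕ} (hk : 3 ≤ k) (hk2 : Even k) :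
    Filter.Tendsto (fun τ => E hk τ) atImInfty (nhds 1) := by
  have hper := SlashInvariantFormClass.periodic_comp_ofComplex (E hk)
    (h := 1) one_mem_strictPeriods_SL
  have han := ModularFormClass.analyticAt_cuspFunction_zero (E hk) (h := 1) one_pos
    one_mem_strictPeriods_SL
  have h0 := E_qExpansion_coeff_zero hk hk2
  have h1 : cuspFunction 1 (E hk) 0 = 1 := by
    rw [← h0, qExpansion_coeff]; simp
  have := han.continuousAt.tendsto.comp (qParam_tendsto_atImInfty (h := 1) one_pos)
  rw [h1] at this
  refine this.congr fun τ => ?_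
  simpa using eq_cuspFunction τ (f := E hk) one_ne_zero hper

theorem aux_exists_tau : ∃ τ : ℍ, g2fun τ ≠ 0 ∧ g3fun τ ≠ 0 := by
  have h4 := (aux_E_tendsto (k := 4) (by norm_num) (by decide)).eventually_ne one_ne_zero
  have h6 := (aux_E_tendsto (k := 6) (by norm_num) (by decide)).eventually_ne one_ne_zero
  obtain ⟨τ, a, b⟩ := (h4.and h6).exists
  have : (Real.pi : ℂ) ≠ 0 := by simp [Real.pi_ne_zero]
  refine ⟨τ, ?_, ?_⟩
  · rw [aux_g2]; exact mul_ne_zero (by simp [Real.pi_ne_zero]) a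
  · rw [aux_g3]; exact mul_ne_zero (by simp [Real.pi_ne_zero]) b

/-- The period pair `(τ, 1)`. -/
def tauPair (τ : ℍ) : PeriodPair where
  ω₁ := τ
  ω₂ := 1
  indep := by
    rw [LinearIndependent.pair_iff]
    intro s t h
    have h1 := congrArg Complex.im h
    have h2 := congrArg Complex.re h
    have hi : (τ : ℂ).im ≠ 0 := τ.im_ne_zero
    simp at h1 h2
    have hs : s = 0 := by
      rcases h1 with h1 | h1
      · exact h1
      · exact absurd h1 τ.im_ne_zero
    subst hs
    simpa using h2

theorem aux_wp (τ : ℍ) (z : ℂ) : wpfun τ z = (tauPair τ).weierstrassP z := by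
  have hs := (tauPair τ).hasSum_weierstrassP z
  rw [← (tauPair τ).latticeEquivProd.symm.toEquiv.hasSum_iff] at hs
  have hf : ((fun l : (tauPair τ).lattice => 1 / (z - l) ^ 2 - 1 / (l : ℂ) ^ 2) ∘
      (tauPair τ).latticeEquivProd.symm.toEquiv)
      = fun p : ℤ × ℤ => (z - latticePt τ p)⁻¹ ^ 2 - (latticePt τ p)⁻¹ ^ 2 := by
    ext p
    have h : (((tauPair τ).latticeEquivProd.symm.toEquiv p : (tauPair τ).lattice) : ℂ)
        = latticePt τ p :=
      ((tauPair τ).latticeEquiv_symm_apply p).trans (by simp [tauPair, latticePt])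
    simp only [Function.comp_apply, h, one_div, inv_pow]
  rw [hf] at hs
  rw [← hs.tsum_eq, ← hs.summable.sum_add_tsum_subtype_compl {0}, wpfun]
  congr 1
  · simp [latticePt]
  · exact ((Equiv.subtypeEquivRight (by simp)).tsum_eq
      (fun p : {p : ℤ × ℤ // p ≠ 0} => (z - latticePt τ p.1)⁻¹ ^ 2 - (latticePt τ p.1)⁻¹ ^ 2)).symm

theorem aux_mem_lattice (τ : ℍ) (w : ℚ × ℚ) :
    (w.1 : ℂ) * τ + (w.2 : ℂ) ∈ (tauPair τ).lattice ↔ IsIntPair w := by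
  have := (tauPair τ).mul_ω₁_add_mul_ω₂_mem_lattice (α := w.1) (β := w.2)
  simp only [tauPair, mul_one] at this
  rw [show (tauPair τ).lattice = (⟨τ, 1, (tauPair τ).indep⟩ : PeriodPair).lattice from rfl, this]
  constructor
  · rintro ⟨h1, h2⟩
    exact ⟨w.1.num, w.2.num, ((Rat.den_eq_one_iff _).1 h1).symm,
      ((Rat.den_eq_one_iff _).1 h2).symm⟩
  · rintro ⟨m, n, h1, h2⟩
    simp [h1, h2]

open Filter Topology in
theorem aux_liouville (L : PeriodPair) (f : ℂ → ℂ) (hf : ∀ x, MeromorphicAt f x)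
    (hper : ∀ z, ∀ w ∈ L.lattice, f (z + w) = f z)
    (hnn : ∀ x, 0 ≤ meromorphicOrderAt f x) (h0 : 0 < meromorphicOrderAt f 0) :
    meromorphicOrderAt f 0 = ⊤ := by
  have hfo : MeromorphicOn f Set.univ := fun x _ => hf x
  set h := toMeromorphicNFOn f Set.univ with hh
  have hord : ∀ x, meromorphicOrderAt h x = meromorphicOrderAt f x := fun x =>
    meromorphicOrderAt_toMeromorphicNFOn hfo (Set.mem_univ x)
  have hnf : MeromorphicNFOn h Set.univ := meromorphicNFOn_toMeromorphicNFOn f Set.univ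
  have han : ∀ x, AnalyticAt ℂ h x := fun x =>
    (hnf (Set.mem_univ x)).meromorphicOrderAt_nonneg_iff_analyticAt.1 (by rw [hord]; exact hnn x)
  have heq : ∀ x, h =ᶠ[𝓝[≠] x] f := fun x =>
    hfo.toMeromorphicNFOn_eq_self_on_nhdsNE (Set.mem_univ x)
  have hdiff : Differentiable ℂ h := fun x => (han x).differentiableAt
  have hcont := hdiff.continuous
  have hperh : ∀ z w, w ∈ L.lattice → h (z + w) = h z := by
    intro z w hw
    have ht : Tendsto (fun y => y + w) (𝓝[≠] z) (𝓝[≠] (z + w)) := by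
      refine tendsto_nhdsWithin_of_tendsto_nhds_of_eventually_within _ ?_ ?_
      · exact ((continuous_id.add continuous_const).tendsto z).mono_left nhdsWithin_le_nhds
      · filter_upwards [self_mem_nhdsWithin] with y hy
        simpa using hy
    have e1 : ∀ᶠ y in 𝓝[≠] z, h (y + w) = h y := by
      filter_upwards [ht.eventually (heq (z + w)), heq z] with y h1 h2
      rw [h1, h2, hper y w hw]
    have t1 : Tendsto (fun y => h (y + w)) (𝓝[≠] z) (𝓝 (h (z + w))) :=
      ((hcont.comp (continuous_id.add continuous_const)).tendsto z).mono_left nhdsWithin_le_nhds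
    have t2 : Tendsto h (𝓝[≠] z) (𝓝 (h z)) := (hcont.tendsto z).mono_left nhdsWithin_le_nhds
    exact tendsto_nhds_unique t1 (t2.congr' (e1.mono fun y hy => hy.symm))
  have hconst : ∀ x, h x = h 0 := fun x =>
    hdiff.apply_eq_apply_of_bounded
      (IsZLattice.isCompact_range_of_periodic L.lattice _ hcont hperh).isBounded x 0
  have hz : h 0 = 0 := by
    have t1 : Tendsto h (𝓝[≠] 0) (𝓝 0) :=
      tendsto_zero_of_meromorphicOrderAt_pos (by rw [hord]; exact h0)
    have t2 : Tendsto h (𝓝[≠] 0) (𝓝 (h 0)) := (hcont.tendsto 0).mono_left nhdsWithin_le_nhds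
    exact tendsto_nhds_unique t2 t1
  rw [← hord, meromorphicOrderAt_eq_top_iff]
  exact Eventually.of_forall fun x => by rw [hconst, hz]

theorem aux_order_periodic (L : PeriodPair) (f : ℂ → ℂ)
    (hper : ∀ z, ∀ w ∈ L.lattice, f (z + w) = f z) (x y : ℂ)
    (hxy : L.lattice.mkQ x = L.lattice.mkQ y) :
    meromorphicOrderAt f x = meromorphicOrderAt f y := by
  have hm : y - x ∈ L.lattice := (Submodule.Quotient.eq _).1 hxy.symm
  have := meromorphicOrderAt_comp_add_const_eq_meromorphicOrderAt (f := f) (x := x) (c := y - x)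
  rw [show x + (y - x) = y by ring] at this
  rw [← this]
  congr 1
  ext z
  exact (hper z _ hm).symm

theorem aux_norm (L : PeriodPair) (f : ℂ → ℂ) (hf : ∀ x, MeromorphicAt f x)
    (hper : ∀ z, ∀ w ∈ L.lattice, f (z + w) = f z)
    (hnt : ∀ x, meromorphicOrderAt f x ≠ ⊤)
    (hnn : ∀ x, x ∉ L.lattice → 0 ≤ meromorphicOrderAt f x)
    (T : AddSubgroup (ℂ ⧸ L.lattice)) [Fintype T]
    (hs : 0 < ∑ t : T, meromorphicOrderAt f (Function.surjInv L.lattice.mkQ_surjective t.1)) :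
    False := by
  set s := Function.surjInv L.lattice.mkQ_surjective with hsdef
  have hsq : ∀ q, L.lattice.mkQ (s q) = q := Function.surjInv_eq L.lattice.mkQ_surjective
  have hmt : ∀ (t : T) x, MeromorphicAt (f ∘ (· + s t)) x := fun t x =>
    meromorphicAt_comp_add_const_iff_meromorphicAt.2 (hf _)
  have hmp : ∀ x, MeromorphicAt (∏ t : T, f ∘ (· + s t)) x := fun x =>
    MeromorphicAt.prod fun t _ => hmt t x
  have hord : ∀ x, meromorphicOrderAt (∏ t : T, f ∘ (· + s t)) x
      = ∑ t : T, meromorphicOrderAt f (x + s t) := by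
    intro x
    rw [meromorphicOrderAt_prod (fun t _ => hmt t x)]
    refine Finset.sum_congr rfl fun t _ => ?_
    exact meromorphicOrderAt_comp_add_const_eq_meromorphicOrderAt
  have hT : ∀ x, L.lattice.mkQ x ∈ T → ∑ t : T, meromorphicOrderAt f (x + s t)
      = ∑ t : T, meromorphicOrderAt f (s t) := by
    intro x hx
    refine Fintype.sum_equiv (Equiv.addLeft (⟨_, hx⟩ : T)) _ _ fun t => ?_
    refine aux_order_periodic L f hper _ _ ?_
    rw [map_add, hsq, hsq]
    rfl
  have hpos : ∀ x, L.lattice.mkQ x ∈ T →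
      0 < meromorphicOrderAt (∏ t : T, f ∘ (· + s t)) x := by
    intro x hx
    rw [hord, hT x hx]
    exact hs
  have key := aux_liouville L (∏ t : T, f ∘ (· + s t)) hmp ?_ ?_ (hpos 0 (by simp))
  · rw [hord] at key
    rw [WithTop.sum_eq_top] at key
    obtain ⟨t, _, ht⟩ := key
    exact hnt _ ht
  · intro z w hw
    simp only [Finset.prod_apply, Function.comp_apply]
    refine Finset.prod_congr rfl fun t _ => ?_
    rw [show z + w + s t = z + s t + w by ring, hper _ w hw]
  · intro x
    by_cases hx : L.lattice.mkQ x ∈ T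
    · exact (hpos x hx).le
    · rw [hord]
      refine Finset.sum_nonneg fun t _ => hnn _ fun hm => hx ?_
      have h1 : L.lattice.mkQ (x + s t) = 0 := (Submodule.Quotient.mk_eq_zero _).2 hm
      rw [map_add, hsq] at h1
      rw [eq_neg_of_add_eq_zero_left h1]
      exact neg_mem t.2

theorem aux_inj (L : PeriodPair) (a b : ℂ) (ha : a ∉ L.lattice) (hb : b ∉ L.lattice)
    (N : ℕ) (hN : 0 < N) (haN : N * a ∈ L.lattice) (hbN : N * b ∈ L.lattice)
    (hab : a - b ∉ L.lattice) (hab' : a + b ∉ L.lattice)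
    (h : L.weierstrassP a = L.weierstrassP b) : False := by
  set c := L.weierstrassP a with hc
  set f : ℂ → ℂ := fun z => L.weierstrassP z - c with hfdef
  have hf : ∀ x, MeromorphicAt f x := fun x =>
    (L.meromorphic_weierstrassP x).sub (MeromorphicAt.const c x)
  have hper : ∀ z, ∀ w ∈ L.lattice, f (z + w) = f z := by
    intro z w hw
    simp only [hfdef]
    rw [L.weierstrassP_add_coe z ⟨w, hw⟩]
  have hanf : ∀ x, x ∉ L.lattice → AnalyticAt ℂ f x := fun x hx =>
    (L.analyticOnNhd_weierstrassP x hx).sub analyticAt_const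
  have h0 : meromorphicOrderAt f 0 = -2 := by
    have h1 := L.order_weierstrassP 0 L.lattice.zero_mem
    have h2 : (0 : WithTop ℤ) ≤ meromorphicOrderAt (fun _ : ℂ => -c) 0 :=
      analyticAt_const.meromorphicOrderAt_nonneg
    have h3 := meromorphicOrderAt_add_eq_left_of_lt (f₁ := L.weierstrassP)
      (f₂ := fun _ : ℂ => -c) (x := 0) (MeromorphicAt.const _ _)
      (by rw [h1]; exact lt_of_lt_of_le (by decide) h2)
    rw [h1] at h3
    rw [← h3]
    congr 1
  have hnt : ∀ x, meromorphicOrderAt f x ≠ ⊤ := fun x =>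
    MeromorphicOn.meromorphicOrderAt_ne_top_of_isPreconnected (U := Set.univ) (x := 0)
      (fun x _ => hf x) isPreconnected_univ (Set.mem_univ _) (Set.mem_univ _) (by rw [h0]; decide)
  have hnn : ∀ x, x ∉ L.lattice → 0 ≤ meromorphicOrderAt f x := fun x hx =>
    (hanf x hx).meromorphicOrderAt_nonneg
  have hone : ∀ x, x ∉ L.lattice → f x = 0 → 1 ≤ meromorphicOrderAt f x := by
    intro x hx hx0
    rw [(hanf x hx).meromorphicOrderAt_eq]
    have : analyticOrderAt f x ≠ 0 := by
      rw [(hanf x hx).analyticOrderAt_ne_zero]; exact hx0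
    revert this
    cases analyticOrderAt f x with
    | top => intro _; exact le_top
    | coe n =>
      intro hn
      have : n ≠ 0 := by exact_mod_cast hn
      have : (1 : ℤ) ≤ (n : ℤ) := by omega
      change ((1 : ℤ) : WithTop ℤ) ≤ ((n : ℤ) : WithTop ℤ)
      exact WithTop.coe_le_coe.2 this
  have htwo : ∀ x, x ∉ L.lattice → x + x ∈ L.lattice → f x = 0 →
      2 ≤ meromorphicOrderAt f x := by
    intro x hx hxx hx0
    have hd : L.derivWeierstrassP x = 0 := by
      have h1 := L.derivWeierstrassP_neg x
      have h2 := L.derivWeierstrassP_add_coe (-x) ⟨x + x, hxx⟩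
      simp only [neg_add_cancel_left] at h2
      rw [← h2] at h1
      exact CharZero.eq_neg_self_iff.1 h1
    have hdf : deriv f = L.derivWeierstrassP := by
      rw [← L.deriv_weierstrassP]
      ext z
      simp [hfdef]
    by_contra hlt
    have h1 : meromorphicOrderAt f x = ((1 : ℤ) : WithTop ℤ) := by
      have := hone x hx hx0
      revert this hlt
      cases meromorphicOrderAt f x with
      | top => intro hlt; exact absurd le_top hlt
      | coe n =>
        intro h1 h2
        have h1' : ¬ (2 : ℤ) ≤ n := fun hh => h1 (by
          change ((2 : ℤ) : WithTop ℤ) ≤ _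
          exact WithTop.coe_le_coe.2 hh)
        have h2' : (1 : ℤ) ≤ n := by
          change ((1 : ℤ) : WithTop ℤ) ≤ _ at h2
          exact WithTop.coe_le_coe.1 h2
        congr 1
        omega
    have h2 := meromorphicOrderAt_deriv_eq_sub_one (by norm_num) h1
    rw [hdf] at h2
    have han := L.analyticOnNhd_derivWeierstrassP x hx
    rw [han.meromorphicOrderAt_eq] at h2
    have h3 : analyticOrderAt L.derivWeierstrassP x ≠ 0 :=
      han.analyticOrderAt_ne_zero.2 hd
    revert h2 h3
    cases analyticOrderAt L.derivWeierstrassP x with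
    | top => intro h2; simp at h2
    | coe n =>
      intro h2 h3
      have h3' : n ≠ 0 := by exact_mod_cast h3
      change ((n : ℤ) : WithTop ℤ) = ((1 - 1 : ℤ) : WithTop ℤ) at h2
      have : (n : ℤ) = 1 - 1 := WithTop.coe_injective h2
      omega
  have fa : f a = 0 := by simp [hfdef, hc]
  have fb : f b = 0 := by simp [hfdef, h]
  have fna : f (-a) = 0 := by simp only [hfdef, L.weierstrassP_neg]; exact fa
  have fnb : f (-b) = 0 := by simp only [hfdef, L.weierstrassP_neg]; exact fb
  set π := L.lattice.mkQ with hπ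
  have hker : ∀ x, π x = 0 ↔ x ∈ L.lattice := fun x => Submodule.Quotient.mk_eq_zero _
  let T : AddSubgroup (ℂ ⧸ L.lattice) := AddSubgroup.closure {π a, π b}
  have hTfin : Finite T := by
    classical
    have hfg : AddGroup.FG T :=
      (AddGroup.fg_iff_addSubgroup_fg T).2 ⟨{π a, π b}, by simp [T]⟩
    refine AddCommGroup.finite_of_fg_isAddTorsion T fun t => ?_
    have hkill : T ≤ (nsmulAddMonoidHom N : (ℂ ⧸ L.lattice) →+ _).ker := by
      refine (AddSubgroup.closure_le _).2 ?_
      rintro x (rfl | rfl)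
      · change N • π a = 0
        rw [← map_nsmul, hker, nsmul_eq_mul]; exact haN
      · change N • π b = 0
        rw [← map_nsmul, hker, nsmul_eq_mul]; exact hbN
    exact isOfFinAddOrder_iff_nsmul_eq_zero.2 ⟨N, hN, Subtype.ext (hkill t.2)⟩
  have : Fintype T := Fintype.ofFinite T
  have hπa : π a ∈ T := AddSubgroup.subset_closure (by simp)
  have hπb : π b ∈ T := AddSubgroup.subset_closure (by simp)
  refine aux_norm L f hf hper hnt hnn T ?_
  set s := Function.surjInv L.lattice.mkQ_surjective with hsdef
  have hsq : ∀ q, π (s q) = q := Function.surjInv_eq L.lattice.mkQ_surjective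
  have ho : ∀ x, meromorphicOrderAt f (s (π x)) = meromorphicOrderAt f x := fun x =>
    aux_order_periodic L f hper _ _ (hsq _)
  have hlow : ∀ S : Finset T, (0 : T) ∈ S →
      ∑ t ∈ S, meromorphicOrderAt f (s t) ≤ ∑ t : T, meromorphicOrderAt f (s t) := by
    intro S hS
    refine Finset.sum_le_sum_of_subset_of_nonneg (Finset.subset_univ _) fun t _ ht => hnn _ ?_
    intro hm
    apply ht
    have := (hker _).2 hm
    rw [hsq] at this
    rwa [show t = 0 from Subtype.ext this]
  have ho0 : meromorphicOrderAt f (s (0 : T)) = -2 := by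
    rw [← h0, ← ho 0, map_zero]; rfl
  have hne : ∀ x y, x - y ∉ L.lattice → π x ≠ π y := fun x y hxy e => by
    apply hxy
    rw [← hker, map_sub, e, sub_self]
  classical
  -- three distinct zeros, or two double zeros
  have three : ∀ x y w : ℂ, x ∉ L.lattice → y ∉ L.lattice → w ∉ L.lattice →
      f x = 0 → f y = 0 → f w = 0 → π x ∈ T → π y ∈ T → π w ∈ T →
      x - y ∉ L.lattice → x - w ∉ L.lattice → y - w ∉ L.lattice →
      0 < ∑ t : T, meromorphicOrderAt f (s t) := by
    intro x y w hx hy hw fx fy fw tx ty tw hxy hxw hyw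
    have hl := hlow {0, ⟨π x, tx⟩, ⟨π y, ty⟩, ⟨π w, tw⟩} (by simp)
    have hx0 : π x ≠ 0 := fun e => hx ((hker x).1 e)
    have hy0 : π y ≠ 0 := fun e => hy ((hker y).1 e)
    have hw0 : π w ≠ 0 := fun e => hw ((hker w).1 e)
    have e1 := hne _ _ hxy
    have e2 := hne _ _ hxw
    have e3 := hne _ _ hyw
    rw [Finset.sum_insert (by simp [Subtype.ext_iff, hx0.symm, hy0.symm, hw0.symm]),
      Finset.sum_insert (by simp [Subtype.ext_iff, e1, e2]),
      Finset.sum_insert (by simp [Subtype.ext_iff, e3]), Finset.sum_singleton, ho0, ho, ho, ho] at hl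
    refine lt_of_lt_of_le ?_ hl
    calc (0 : WithTop ℤ) < -2 + (1 + (1 + 1)) := by decide
      _ ≤ _ := by gcongr <;> apply hone <;> assumption
  have ta' : π (-a) ∈ T := by rw [map_neg]; exact neg_mem hπa
  have tb' : π (-b) ∈ T := by rw [map_neg]; exact neg_mem hπb
  have hna : -a ∉ L.lattice := fun e => ha (neg_mem_iff.1 e)
  have hnb : -b ∉ L.lattice := fun e => hb (neg_mem_iff.1 e)
  by_cases haa : a + a ∈ L.lattice
  · by_cases hbb : b + b ∈ L.lattice
    · have hl := hlow {0, ⟨π a, hπa⟩, ⟨π b, hπb⟩} (by simp)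
      have hx0 : π a ≠ 0 := fun e => ha ((hker a).1 e)
      have hy0 : π b ≠ 0 := fun e => hb ((hker b).1 e)
      have e1 := hne _ _ hab
      rw [Finset.sum_insert (by simp [Subtype.ext_iff, hx0.symm, hy0.symm]),
        Finset.sum_insert (by simp [Subtype.ext_iff, e1]), Finset.sum_singleton,
        ho0, ho, ho] at hl
      refine lt_of_lt_of_le ?_ hl
      calc (0 : WithTop ℤ) < -2 + (2 + 2) := by decide
        _ ≤ _ := by gcongr <;> apply htwo <;> assumption
    · refine three b (-b) a hb hnb ha fb fnb fa hπb tb' hπa (by simpa using hbb) ?_ ?_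
      · intro e; exact hab (by simpa using neg_mem e)
      · intro e; exact hab' (by simpa [add_comm] using neg_mem e)
  · refine three a (-a) b ha hna hb fa fna fb hπa ta' hπb (by simpa using haa) hab ?_
    intro e; exact hab' (by simpa [add_comm] using neg_mem e)

/-- For `u, v ∈ ℚ² ∖ ℤ²`, one has `f_u = f_v` if and only if
`u ≡ ±v (mod ℤ²)`. -/
theorem fricke_eq_iff (u v : ℚ × ℚ) (hu : ¬ IsIntPair u) (hv : ¬ IsIntPair v) :
    fricke u = fricke v ↔ PMEquiv u v := by
  constructor
  · intro h
    obtain ⟨τ, h2, h3⟩ := aux_exists_tau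
    have hd := aux_delta_ne τ
    have e := congrFun h τ
    unfold fricke at e
    have hc : -(2 ^ 7 * 3 ^ 5 : ℂ) * g2fun τ * g3fun τ / deltaFun τ ≠ 0 := by
      refine div_ne_zero (mul_ne_zero (mul_ne_zero ?_ h2) h3) hd
      norm_num
    have e := mul_left_cancel₀ hc e
    rw [aux_wp, aux_wp] at e
    by_contra hpm
    have key : ∀ w : ℚ × ℚ, ∀ M : ℕ, IsIntPair (M * w.1, M * w.2) →
        (M : ℂ) * ((w.1 : ℂ) * τ + (w.2 : ℂ)) ∈ (tauPair τ).lattice := by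
      intro w M hM
      have := (aux_mem_lattice τ (M * w.1, M * w.2)).2 hM
      convert this using 1
      push_cast
      ring
    have hden : ∀ q : ℚ, (q.den : ℚ) * q = q.num := fun q => by
      rw [mul_comm]; exact Rat.mul_den_eq_num q
    refine aux_inj (tauPair τ) _ _ (fun hm => hu ((aux_mem_lattice τ u).1 hm))
      (fun hm => hv ((aux_mem_lattice τ v).1 hm))
      (u.1.den * u.2.den * (v.1.den * v.2.den)) ?_ ?_ ?_ ?_ ?_ e
    · have := u.1.den_pos
      have := u.2.den_pos
      have := v.1.den_pos
      have := v.2.den_pos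
      positivity
    · refine key u _ ⟨u.2.den * (v.1.den * v.2.den) * u.1.num,
        u.1.den * (v.1.den * v.2.den) * u.2.num, ?_, ?_⟩
      · push_cast; rw [← hden]; ring
      · push_cast; rw [← hden u.2]; ring
    · refine key v _ ⟨u.1.den * u.2.den * v.2.den * v.1.num,
        u.1.den * u.2.den * v.1.den * v.2.num, ?_, ?_⟩
      · push_cast; rw [← hden]; ring
      · push_cast; rw [← hden v.2]; ring
    · intro hm
      refine hpm (Or.inl ((aux_mem_lattice τ _).1 ?_))
      convert hm using 1
      push_cast
      ring
    · intro hm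
      refine hpm (Or.inr ((aux_mem_lattice τ _).1 ?_))
      convert hm using 1
      push_cast
      ring
  · intro h
    funext τ
    unfold fricke
    congr 1
    rw [aux_wp, aux_wp]
    rcases h with h | h
    · have hm := (aux_mem_lattice τ _).2 h
      rw [← (tauPair τ).weierstrassP_add_coe ((v.1 : ℂ) * τ + (v.2 : ℂ)) ⟨_, hm⟩]
      congr 1
      push_cast
      ring
    · have hm := (aux_mem_lattice τ _).2 h
      rw [← (tauPair τ).weierstrassP_neg ((v.1 : ℂ) * τ + (v.2 : ℂ)),
        ← (tauPair τ).weierstrassP_add_coe (-((v.1 : ℂ) * τ + (v.2 : ℂ))) ⟨_, hm⟩]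
      congr 1
      push_cast
      ring

end
end

section
/- For each γ ∈ SL₂(ℤ) there exists a 12th root of unity ζ, depending only on γ, such that for every v ∈ ℚ² ∖ ℤ² and every τ ∈ ℍ one has g_v(γ(τ)) = ζ · g_{ᵗγ·v}(τ), where γ acts on ℍ by fractional linear transformation and ᵗγ is the transpose of γ. -/
noncomputable section

open Complex Matrix UpperHalfPlane MatrixGroups

/-- The `q`-Pochhammer product `∏ (1 - q ^ n u)`. -/
def poch (q u : ℂ) : ℂ := ∏' n : ℕ, (1 - q ^ n * u)

lemma poch_multipliable {q : ℂ} (hq : ‖q‖ < 1) (u : ℂ) :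
    Multipliable fun n : ℕ => (1 - q ^ n * u) := by
  simp_rw [sub_eq_add_neg]
  apply multipliable_one_add_of_summable
  simpa using (summable_geometric_of_lt_one (norm_nonneg _) hq).mul_right ‖u‖

lemma poch_succ {q : ℂ} (hq : ‖q‖ < 1) (u : ℂ) : poch q u = (1 - u) * poch q (q * u) := by
  have h2 : ∀ n : ℕ, 1 - q ^ (n + 1) * u = 1 - q ^ n * (q * u) := fun n => by ring
  have h : Multipliable (fun n : ℕ => 1 - q ^ (n + 1) * u) := by
    simp_rw [h2]
    exact poch_multipliable hq (q * u)
  have h3 := tprod_eq_zero_mul' (f := fun n : ℕ => 1 - q ^ n * u) h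
  simp_rw [h2] at h3
  simpa [poch] using h3

lemma poch_differentiable {q : ℂ} (hq : ‖q‖ < 1) : Differentiable ℂ (poch q) := by
  rw [← differentiableOn_univ]
  have hu : HasProdLocallyUniformlyOn (fun (n : ℕ) u => 1 + -(q ^ n * u)) 
      (fun u => ∏' n : ℕ, (1 + -(q ^ n * u))) (Set.univ : Set ℂ) := by
    apply hasProdLocallyUniformlyOn_of_forall_compact isOpen_univ
    intro K _ hcK
    obtain ⟨C, hC⟩ := hcK.isBounded.exists_norm_le
    refine ((summable_geometric_of_lt_one (norm_nonneg _) hq).mul_right C).hasProdUniformlyOn_nat_one_add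
      hcK (.of_forall fun n x hx ↦ ?_) (fun _ ↦ by fun_prop)
    simpa using mul_le_mul_of_nonneg_left (hC x hx) (by positivity)
  have := hu.differentiableOn (.of_forall fun s ↦ by
    have : DifferentiableOn ℂ (fun u : ℂ => ∏ n ∈ s, (1 + -(q ^ n * u))) Set.univ :=
      DifferentiableOn.fun_finsetProd (fun _ _ ↦ by fun_prop)
    simpa [Finset.prod_fn] using this) isOpen_univ
  simpa [poch, sub_eq_add_neg] using! this

lemma shift_int {G : ℂ → ℂ} (hG : Differentiable ℂ G) (hp : ∀ z, G (z + 1) = G z) (τ : ℂ) :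
    ∫ x in (0:ℝ)..1, G (x + τ) = ∫ x in (0:ℝ)..1, G x := by
  have h := Complex.integral_boundary_rect_eq_zero_of_differentiableOn G 0 (1 + τ.im * Complex.I)
    hG.differentiableOn
  have h1 : ∀ y : ℝ, G (1 + y * Complex.I) = G (y * Complex.I) := fun y => by rw [add_comm, hp]
  simp [h1] at h
  have hper : Function.Periodic (fun x : ℝ => G (x + τ.im * Complex.I)) 1 := by
    intro x
    simp only
    rw [← hp (x + τ.im * Complex.I)]
    push_cast; ring_nf
  have h3 := hper.intervalIntegral_add_eq τ.re 0
  have h4 : ∫ x in (0:ℝ)..1, G (x + τ) = ∫ x in (0:ℝ)..1, (fun x : ℝ => G (x + τ.im * Complex.I)) (x + τ.re) := by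
    congr 1
    funext x
    simp only
    congr 1
    push_cast
    conv_lhs => rw [← re_add_im τ]
    ring
  rw [h4, intervalIntegral.integral_comp_add_right (fun x : ℝ => G (x + τ.im * Complex.I))]
  rw [zero_add] at h3
  rw [zero_add, add_comm, h3]
  rw [sub_eq_zero] at h
  exact h.symm

lemma eq_zero_of_coeff {f : ℂ → ℂ} (hf : Differentiable ℂ f) (hp : ∀ z, f (z + 1) = f z)
    (h0 : ∀ n : ℤ, ∫ x in (0:ℝ)..1, cexp (-(2 * Real.pi * Complex.I * n * x)) * f x = 0) : f = 0 := by
  have hper : Function.Periodic (fun x : ℝ => f x) 1 := by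
    intro x
    simp [hp]
  have : Fact ((0:ℝ) < 1) := ⟨one_pos⟩
  let F : C(AddCircle (1:ℝ), ℂ) := ⟨hper.lift, by
    apply continuous_coinduced_dom.mpr
    have : Continuous (fun x : ℝ => f x) := hf.continuous.comp continuous_ofReal
    exact this⟩
  have hF : ∀ x : ℝ, F (x : AddCircle (1:ℝ)) = f x := fun x => hper.lift_coe x
  have hc : fourierCoeff (F : AddCircle (1:ℝ) → ℂ) = 0 := by
    funext n
    rw [fourierCoeff_eq_intervalIntegral _ _ 0]
    simp only [zero_add, hF, fourier_coe_apply, Pi.zero_apply, smul_eq_mul]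
    have h1 : ∀ x : ℝ, cexp (2 * Real.pi * Complex.I * ((-n : ℤ) : ℂ) * x / (1 : ℝ)) * f x
        = cexp (-(2 * Real.pi * Complex.I * n * x)) * f x := by
      intro x
      push_cast
      ring_nf
    simp only [h1, h0 n, smul_zero]
  have hR : ∀ x : ℝ, f x = 0 := by
    intro x
    have := has_pointwise_sum_fourier_series_of_summable (f := F) (by rw [hc]; exact summable_zero) x
    rw [hc] at this
    simp only [Pi.zero_apply, zero_smul] at this
    rw [← hF]
    exact this.unique hasSum_zero
  have han : AnalyticOnNhd ℂ f Set.univ := fun z _ => hf.analyticAt z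
  have := han.eqOn_zero_of_preconnected_of_frequently_eq_zero isPreconnected_univ
    (Set.mem_univ (0:ℂ)) ?_
  · funext z; exact this (Set.mem_univ z)
  · have ht : Filter.Tendsto (fun n : ℕ => ((1 / ((n:ℝ) + 1) : ℝ) : ℂ)) Filter.atTop (nhdsWithin 0 {0}ᶜ) := by
      rw [tendsto_nhdsWithin_iff]
      constructor
      · have := (continuous_ofReal.tendsto 0).comp (tendsto_one_div_add_atTop_nhds_zero_nat (𝕜 := ℝ))
        rw [ofReal_zero] at this
        exact this
      · refine .of_forall fun n => ?_
        simp only [Set.mem_compl_iff, Set.mem_singleton_iff, ofReal_eq_zero]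
        positivity
    exact ht.frequently (Filter.Frequently.of_forall fun n => hR _)

/-- Theta-type functions with automorphy factor `-e(-z)`. -/
structure IsTh (τ : ℂ) (f : ℂ → ℂ) : Prop where
  diff : Differentiable ℂ f
  one : ∀ z, f (z + 1) = f z
  tau : ∀ z, f (z + τ) = -cexp (-(2 * Real.pi * Complex.I * z)) * f z

/-- Fourier coefficient. -/
def fc (f : ℂ → ℂ) (n : ℤ) : ℂ := ∫ x in (0:ℝ)..1, cexp (-(2 * Real.pi * Complex.I * n * x)) * f x

lemma fc_rec {τ : ℂ} {f : ℂ → ℂ} (h : IsTh τ f) (n : ℤ) :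
    cexp (2 * Real.pi * Complex.I * n * τ) * fc f n = - fc f (n + 1) := by
  have hd := h.diff
  have := shift_int (G := fun z => cexp (-(2 * Real.pi * Complex.I * n * z)) * f z) (by fun_prop) ?_ τ
  · rw [fc, ← this, fc, ← intervalIntegral.integral_const_mul, ← intervalIntegral.integral_neg]
    congr 1
    funext x
    have e : cexp (-(2 * Real.pi * Complex.I * ((n + 1 : ℤ) : ℂ) * x)) =
        cexp (2 * Real.pi * Complex.I * n * τ) * cexp (-(2 * Real.pi * Complex.I * n * (x + τ))) *
          cexp (-(2 * Real.pi * Complex.I * x)) := by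
      rw [← Complex.exp_add, ← Complex.exp_add]
      push_cast
      ring_nf
    rw [h.tau, e]
    ring
  · intro z
    simp only [h.one]
    congr 1
    rw [Complex.exp_eq_exp_iff_exists_int]
    exact ⟨-n, by push_cast; ring⟩

lemma IsTh.eq_zero {τ : ℂ} {f : ℂ → ℂ} (h : IsTh τ f) (h0 : fc f 0 = 0) : f = 0 := by
  apply eq_zero_of_coeff h.diff h.one
  have h1 : ∀ n : ℤ, fc f n = 0 ↔ fc f (n + 1) = 0 := by
    intro n
    rw [← neg_eq_zero (a := fc f (n + 1)), ← fc_rec h n]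
    simp [Complex.exp_ne_zero]
  intro n
  change fc f n = 0
  induction n using Int.induction_on with
  | zero => exact h0
  | succ i hi => exact (h1 _).1 hi
  | pred i hi => 
    rw [h1]; simpa using hi

lemma IsTh.comb {τ : ℂ} {f g : ℂ → ℂ} (hf : IsTh τ f) (hg : IsTh τ g) :
    ∀ z, fc g 0 * f z = fc f 0 * g z := by
  have hd := hf.diff
  have hd' := hg.diff
  have h : IsTh τ (fun z => fc g 0 * f z - fc f 0 * g z) := by
    refine ⟨by fun_prop, fun z => ?_, fun z => ?_⟩
    · simp only [hf.one, hg.one]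
    · simp only [hf.tau, hg.tau]; ring
  have := h.eq_zero (by
    have c1 : Continuous (fun x : ℝ => f x) := hd.continuous.comp continuous_ofReal
    have c2 : Continuous (fun x : ℝ => g x) := hd'.continuous.comp continuous_ofReal
    simp only [fc, Int.cast_zero, mul_zero, zero_mul, neg_zero, Complex.exp_zero, one_mul]
    rw [intervalIntegral.integral_sub ((c1.const_mul _).intervalIntegrable _ _)
      ((c2.const_mul _).intervalIntegrable _ _), intervalIntegral.integral_const_mul,
      intervalIntegral.integral_const_mul]
    ring)
  intro z
  have := congrFun this z
  simpa [sub_eq_zero] using this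

lemma IsTh.prop {τ : ℂ} {f g : ℂ → ℂ} (hf : IsTh τ f) (hg : IsTh τ g) {a b : ℂ}
    (ha : HasDerivAt f a 0) (hb : HasDerivAt g b 0) (hb0 : b ≠ 0) (z : ℂ) :
    f z = a / b * g z := by
  have h := hf.comb hg
  have hA : fc g 0 ≠ 0 := by
    intro h0
    have := hg.eq_zero h0
    subst this
    exact hb0 (hb.unique (hasDerivAt_const _ _))
  have h1 : fc g 0 * a = fc f 0 * b := by
    have e : (fun z => fc g 0 * f z) = fun z => fc f 0 * g z := funext h
    have h2 := ha.const_mul (fc g 0)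
    rw [e] at h2
    exact h2.unique (hb.const_mul _)
  have h3 := h z
  field_simp
  apply mul_left_cancel₀ hA
  linear_combination b * h3 - g z * h1

/-- The theta product in the variable `z`. -/
def thP (τ z : ℂ) : ℂ :=
  poch (cexp (2 * Real.pi * Complex.I * τ)) (cexp (2 * Real.pi * Complex.I * z)) *
    poch (cexp (2 * Real.pi * Complex.I * τ))
      (cexp (2 * Real.pi * Complex.I * τ) * cexp (-(2 * Real.pi * Complex.I * z)))

lemma norm_q_lt (τ : ℍ) : ‖cexp (2 * Real.pi * Complex.I * τ)‖ < 1 := norm_exp_two_pi_I_lt_one τ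

lemma thP_isTh (τ : ℍ) : IsTh τ (thP τ) := by
  have hq := norm_q_lt τ
  have hd := poch_differentiable hq
  refine ⟨?_, fun z => ?_, fun z => ?_⟩
  · unfold thP
    fun_prop
  · have e1 : cexp (2 * Real.pi * Complex.I * (z + 1)) = cexp (2 * Real.pi * Complex.I * z) := by
      rw [mul_add, mul_one, Complex.exp_add, Complex.exp_two_pi_mul_I, mul_one]
    simp only [thP, Complex.exp_neg, e1]
  · have e1 : cexp (2 * Real.pi * Complex.I * (z + τ)) =
        cexp (2 * Real.pi * Complex.I * τ) * cexp (2 * Real.pi * Complex.I * z) := by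
      rw [← Complex.exp_add]; ring_nf
    have e2 : cexp (2 * Real.pi * Complex.I * τ) * cexp (-(2 * Real.pi * Complex.I * (z + τ))) =
        cexp (-(2 * Real.pi * Complex.I * z)) := by
      rw [← Complex.exp_add]; ring_nf
    have e3 : cexp (-(2 * Real.pi * Complex.I * z)) * cexp (2 * Real.pi * Complex.I * z) = 1 := by
      rw [← Complex.exp_add]; simp
    rw [thP, thP, e1, e2, poch_succ hq (cexp (-(2 * Real.pi * Complex.I * z))),
      poch_succ hq (cexp (2 * Real.pi * Complex.I * z))]
    linear_combination (-poch (cexp (2 * Real.pi * Complex.I * τ))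
        (cexp (2 * Real.pi * Complex.I * τ) * cexp (2 * Real.pi * Complex.I * z)) *
      poch (cexp (2 * Real.pi * Complex.I * τ))
        (cexp (2 * Real.pi * Complex.I * τ) * cexp (-(2 * Real.pi * Complex.I * z)))) * e3

lemma thP_zero (τ : ℍ) : thP τ 0 = 0 := by
  rw [thP, poch_succ (norm_q_lt τ)]
  simp

lemma thP_deriv (τ : ℍ) : HasDerivAt (thP τ) (-(2 * Real.pi * Complex.I) *
    poch (cexp (2 * Real.pi * Complex.I * τ)) (cexp (2 * Real.pi * Complex.I * τ)) ^ 2) 0 := by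
  have hq := norm_q_lt τ
  have hd := poch_differentiable hq
  set q := cexp (2 * Real.pi * Complex.I * τ) with hqd
  let R : ℂ → ℂ := fun z => poch q (q * cexp (2 * Real.pi * Complex.I * z)) *
    poch q (q * cexp (-(2 * Real.pi * Complex.I * z)))
  have hR : Differentiable ℂ R := by
    simp only [R]; fun_prop
  have he : thP τ = fun z => (1 - cexp (2 * Real.pi * Complex.I * z)) * R z := by
    funext z
    rw [thP, ← hqd, poch_succ hq (cexp (2 * Real.pi * Complex.I * z))]
    simp only [R]; ring
  rw [he]
  have h1 : HasDerivAt (fun z : ℂ => 1 - cexp (2 * Real.pi * Complex.I * z))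
      (-(2 * Real.pi * Complex.I)) 0 := by
    have := (((hasDerivAt_id (0:ℂ)).const_mul (2 * Real.pi * Complex.I)).cexp).const_sub 1
    simpa using this
  have h2 := h1.mul (hR 0).hasDerivAt
  convert! h2 using 1
  simp [R]
  ring

/-- Inversion on the upper half plane. -/
def sH (τ : ℍ) : ℍ := UpperHalfPlane.mk (-τ : ℂ)⁻¹ τ.im_inv_neg_coe_pos

lemma sH_coe (τ : ℍ) : (sH τ : ℂ) = -1 / τ := by
  simp [sH, neg_div, inv_neg]

/-- The transformed theta product. -/
def thS (τ : ℍ) (z : ℂ) : ℂ := thP (sH τ) (z / τ) *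
  cexp (Real.pi * Complex.I * (-z ^ 2 / τ + z - z / τ))

lemma thS_isTh (τ : ℍ) : IsTh τ (thS τ) := by
  have h := thP_isTh (sH τ)
  have hd := h.diff
  have hτ : (τ : ℂ) ≠ 0 := τ.ne_zero
  refine ⟨?_, fun z => ?_, fun z => ?_⟩
  · unfold thS
    fun_prop
  · have h1 := h.tau ((z + 1) / τ)
    have e : (z + 1) / (τ:ℂ) + sH τ = z / τ := by rw [sH_coe]; field_simp; ring
    rw [e] at h1
    rw [thS, thS, h1]
    have e2 : cexp (Real.pi * Complex.I * (-(z + 1) ^ 2 / τ + (z + 1) - (z + 1) / τ)) =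
      - cexp (-(2 * Real.pi * Complex.I * ((z + 1) / τ))) *
        cexp (Real.pi * Complex.I * (-z ^ 2 / τ + z - z / τ)) := by
      have hn : ∀ A : ℂ, -cexp A = cexp (Real.pi * Complex.I + A) := by
        intro A
        rw [Complex.exp_add, Complex.exp_pi_mul_I, neg_one_mul]
      rw [hn, ← Complex.exp_add]
      congr 1
      field_simp
      ring
    rw [e2]
    ring
  · have h1 := h.one (z / τ)
    have e : (z + τ) / (τ:ℂ) = z / τ + 1 := by field_simp
    rw [thS, thS, e, h1]
    have e2 : cexp (Real.pi * Complex.I * (-(z + τ) ^ 2 / τ + (z + τ) - (z / τ + 1))) =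
      - cexp (-(2 * Real.pi * Complex.I * z)) *
        cexp (Real.pi * Complex.I * (-z ^ 2 / τ + z - z / τ)) := by
      have hn : ∀ A : ℂ, -cexp A = cexp (-(Real.pi * Complex.I) + A) := by
        intro A
        rw [Complex.exp_add, Complex.exp_neg, Complex.exp_pi_mul_I]; norm_num
      rw [hn, ← Complex.exp_add]
      congr 1
      field_simp
      ring
    rw [e2]
    ring

lemma thS_deriv (τ : ℍ) : HasDerivAt (thS τ) (-(2 * Real.pi * Complex.I) *
    poch (cexp (2 * Real.pi * Complex.I * sH τ)) (cexp (2 * Real.pi * Complex.I * sH τ)) ^ 2 / τ)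
    0 := by
  have h0 := thP_deriv (sH τ)
  have h1 : HasDerivAt (fun z : ℂ => z / τ) (1 / τ) 0 := (hasDerivAt_id (0:ℂ)).div_const _
  have h2 := HasDerivAt.comp (0:ℂ) (h₂ := thP (sH τ)) (h := fun z : ℂ => z / τ) (by simpa using h0) h1
  have h3 : DifferentiableAt ℂ
    (fun z : ℂ => cexp (Real.pi * Complex.I * (-z ^ 2 / τ + z - z / τ))) 0 := by fun_prop
  have h4 := h2.mul h3.hasDerivAt
  convert! h4 using 1
  simp [thP_zero]
  ring

lemma eta_eq (τ : ℍ) : ModularForm.eta τ = cexp (2 * Real.pi * Complex.I * τ / 24) *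
    poch (cexp (2 * Real.pi * Complex.I * τ)) (cexp (2 * Real.pi * Complex.I * τ)) := by
  rw [ModularForm.eta, poch]
  simp only [pow_succ, Function.Periodic.qParam]
  norm_num

lemma poch_S (τ : ℍ) :
    poch (cexp (2 * Real.pi * Complex.I * sH τ)) (cexp (2 * Real.pi * Complex.I * sH τ)) ^ 2 =
    -Complex.I * τ * cexp (Real.pi * Complex.I * (τ - sH τ) / 6) *
    poch (cexp (2 * Real.pi * Complex.I * τ)) (cexp (2 * Real.pi * Complex.I * τ)) ^ 2 := by
  have h := ModularForm.eta_comp_eq_csqrt_I_inv τ.2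
  simp only [Function.comp_apply, Pi.smul_apply, Pi.mul_apply, smul_eq_mul] at h
  change ModularForm.eta (-1 / (τ:ℂ)) = _ * (_ * ModularForm.eta (τ:ℂ)) at h
  rw [← sH_coe, eta_eq, eta_eq] at h
  have hs : ∀ z : ℂ, z ≠ 0 → Complex.sqrt z ^ 2 = z := by
    intro z hz
    rw [_root_.sqrt_eq_exp hz, ← Complex.exp_nat_mul]
    rw [show ((2:ℕ):ℂ) * (Complex.log z / 2) = Complex.log z by push_cast; ring, Complex.exp_log hz]
  have h2 := congrArg (· ^ 2) h
  simp only [mul_pow, inv_pow] at h2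
  rw [hs _ Complex.I_ne_zero] at h2
  change _ = _ * (Complex.sqrt (τ:ℂ) ^ 2 * _) at h2
  rw [hs _ τ.ne_zero, Complex.inv_I] at h2
  have e : cexp (2 * Real.pi * Complex.I * τ / 24) ^ 2 =
      cexp (Real.pi * Complex.I * (τ - sH τ) / 6) *
        cexp (2 * Real.pi * Complex.I * sH τ / 24) ^ 2 := by
    rw [← Complex.exp_nat_mul, ← Complex.exp_nat_mul, ← Complex.exp_add]
    push_cast
    ring_nf
  rw [e] at h2
  apply mul_left_cancel₀ (pow_ne_zero 2
    (Complex.exp_ne_zero (2 * Real.pi * Complex.I * sH τ / 24)))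
  rw [h2]
  ring

lemma thS_eq (τ : ℍ) (z : ℂ) : thS τ z =
    -Complex.I * cexp (Real.pi * Complex.I * (τ - sH τ) / 6) * thP τ z := by
  have hp : poch (cexp (2 * Real.pi * Complex.I * τ)) (cexp (2 * Real.pi * Complex.I * τ)) ≠ 0 := by
    have := ModularForm.eta_ne_zero τ.2
    change ModularForm.eta (τ:ℂ) ≠ 0 at this
    rw [eta_eq] at this
    exact right_ne_zero_of_mul this
  have hτ : (τ : ℂ) ≠ 0 := τ.ne_zero
  have hpi : (2 * Real.pi * Complex.I : ℂ) ≠ 0 := Complex.two_pi_I_ne_zero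
  rw [(thS_isTh τ).prop (thP_isTh τ) (thS_deriv τ) (thP_deriv τ)
    (mul_ne_zero (neg_ne_zero.2 hpi) (pow_ne_zero 2 hp)), poch_S]
  congr 1
  field_simp

lemma siegel_eq (v : ℚ × ℚ) (τ : ℍ) : siegel v τ =
    -cexp (Real.pi * Complex.I * (v.2 * (v.1 - 1) + τ * (v.1 ^ 2 - v.1 + 1 / 6))) *
      thP τ (v.1 * τ + v.2) := by
  have hq := norm_q_lt τ
  rw [siegel, thP, poch_succ hq (cexp (2 * Real.pi * Complex.I * (v.1 * τ + v.2))), mul_assoc (1 - _),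
    poch, poch, ← (poch_multipliable hq _).tprod_mul (poch_multipliable hq _), ← mul_assoc]
  congr 1
  · congr 1
    · rw [qpow, neg_mul, ← Complex.exp_add]
      congr 2
      ring
    · rw [qpow, e2pi, ← Complex.exp_add]
      congr 2
      ring
  · congr 1
    funext n
    simp only [qpow, e2pi, ← Complex.exp_nat_mul, ← Complex.exp_add]
    congr 3
    · ring
    · ring

lemma siegel_S (v : ℚ × ℚ) (τ : ℍ) : siegel v (ModularGroup.S • τ) =
    -Complex.I * siegel (v.2, -v.1) τ := by
  have hτ : (τ : ℂ) ≠ 0 := τ.ne_zero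
  have hS : ModularGroup.S • τ = sH τ := UpperHalfPlane.modular_S_smul τ
  have h := thS_eq τ (v.2 * τ - v.1)
  have e0 : ((v.2 : ℂ) * τ - v.1) / τ = v.1 * sH τ + v.2 := by
    rw [sH_coe]; field_simp; ring
  rw [thS, e0] at h
  rw [hS, siegel_eq, siegel_eq]
  push_cast
  rw [← sub_eq_add_neg]
  apply mul_right_cancel₀ (Complex.exp_ne_zero (Real.pi * Complex.I *
    (-((v.2 : ℂ) * τ - v.1) ^ 2 / τ + (v.2 * τ - v.1) - (v.1 * sH τ + v.2))))
  rw [mul_assoc, h]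
  have e : cexp (Real.pi * Complex.I * (v.2 * (v.1 - 1) + sH τ * (v.1 ^ 2 - v.1 + 1 / 6))) *
      cexp (Real.pi * Complex.I * (τ - sH τ) / 6) =
      cexp (Real.pi * Complex.I * (-v.1 * (v.2 - 1) + τ * (v.2 ^ 2 - v.2 + 1 / 6))) *
      cexp (Real.pi * Complex.I *
    (-((v.2 : ℂ) * τ - v.1) ^ 2 / τ + (v.2 * τ - v.1) - (v.1 * sH τ + v.2))) := by
    rw [← Complex.exp_add, ← Complex.exp_add, sH_coe]
    congr 1
    field_simp
    ring
  linear_combination (Complex.I * thP τ (v.2 * τ - v.1)) * e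

lemma thP_T (τ z : ℂ) : thP (τ + 1) z = thP τ z := by
  have e1 : cexp (2 * Real.pi * Complex.I * (τ + 1)) = cexp (2 * Real.pi * Complex.I * τ) := by
    rw [mul_add, mul_one, Complex.exp_add, Complex.exp_two_pi_mul_I, mul_one]
  rw [thP, thP, e1]

lemma siegel_T (v : ℚ × ℚ) (τ : ℍ) : siegel v (ModularGroup.T • τ) =
    cexp (Real.pi * Complex.I / 6) * siegel (v.1, v.1 + v.2) τ := by
  have hT : ((ModularGroup.T • τ : ℍ) : ℂ) = τ + 1 := by
    rw [UpperHalfPlane.modular_T_smul]; simp [add_comm]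
  rw [siegel_eq, siegel_eq, hT, thP_T]
  push_cast
  rw [show (v.1 : ℂ) * (τ + 1) + v.2 = v.1 * τ + (v.1 + v.2) by ring, ← mul_assoc, mul_neg,
    ← Complex.exp_add]
  congr 3
  ring

/-- The transformation property of the theorem, for all `v`. -/
def Good (γ : SL2Z) : Prop := ∃ ζ : ℂ, ζ ^ 12 = 1 ∧ ∀ v : ℚ × ℚ, ∀ τ : ℍ,
  siegel v (γ • τ) = ζ * siegel (tAct (γ : Matrix (Fin 2) (Fin 2) ℤ) v) τ

lemma tAct_mul (A B : Matrix (Fin 2) (Fin 2) ℤ) (v : ℚ × ℚ) :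
    tAct (A * B) v = tAct B (tAct A v) := by
  simp only [tAct, Matrix.mul_apply, Fin.sum_univ_two]
  push_cast
  ext <;> ring

lemma tAct_one (v : ℚ × ℚ) : tAct 1 v = v := by
  simp [tAct]

lemma good_all (γ : SL2Z) : Good γ := by
  have hγ : γ ∈ Subgroup.closure {ModularGroup.S, ModularGroup.T} := by
    simp [SpecialLinearGroup.SL2Z_generators]
  induction hγ using Subgroup.closure_induction with
  | mem x hx =>
    rcases hx with rfl | rfl
    · refine ⟨-Complex.I, ?_, fun v τ => ?_⟩
      · rw [show 12 = 4 * 3 by norm_num, pow_mul, neg_pow, Complex.I_pow_four]; norm_num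
      · rw [siegel_S]
        congr 2
        simp [tAct, ModularGroup.S]
    · refine ⟨cexp (Real.pi * Complex.I / 6), ?_, fun v τ => ?_⟩
      · rw [← Complex.exp_nat_mul, ← Complex.exp_two_pi_mul_I]
        congr 1
        push_cast
        ring
      · rw [siegel_T]
        congr 2
        simp [tAct, ModularGroup.T]
  | one => exact ⟨1, by simp, fun v τ => by simp [tAct_one]⟩
  | mul x y _ _ hx hy =>
    obtain ⟨a, ha, hx⟩ := hx
    obtain ⟨b, hb, hy⟩ := hy
    refine ⟨a * b, by rw [mul_pow, ha, hb, one_mul], fun v τ => ?_⟩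
    rw [mul_smul, hx, hy, Matrix.SpecialLinearGroup.coe_mul, tAct_mul, mul_assoc]
  | inv x _ hx =>
    obtain ⟨a, ha, hx⟩ := hx
    refine ⟨a⁻¹, by rw [inv_pow, ha, inv_one], fun v τ => ?_⟩
    have h := hx (tAct ((x⁻¹ : SL2Z) : Matrix (Fin 2) (Fin 2) ℤ) v) (x⁻¹ • τ)
    rw [smul_inv_smul, ← tAct_mul, ← Matrix.SpecialLinearGroup.coe_mul, inv_mul_cancel,
      Matrix.SpecialLinearGroup.coe_one, tAct_one] at h
    have ha0 : a ≠ 0 := by rintro rfl; simp at ha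
    rw [h, inv_mul_cancel_left₀ ha0]

/-- For each `γ ∈ SL₂(ℤ)` there is a `12`-th root of unity `ζ`,
depending only on `γ`, with `g_v(γτ) = ζ·g_{ᵗγ·v}(τ)` for all `v ∈ ℚ² ∖ ℤ²`, `τ ∈ ℍ`. -/
theorem siegel_slash (γ : SL2Z) :
    ∃ ζ : ℂ, ζ ^ 12 = 1 ∧
      ∀ v : ℚ × ℚ, ¬ IsIntPair v → ∀ τ : ℍ,
        siegel v (γ • τ) = ζ * siegel (tAct (γ : Matrix (Fin 2) (Fin 2) ℤ) v) τ := by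
  obtain ⟨ζ, h1, h2⟩ := good_all γ
  exact ⟨ζ, h1, fun v _ τ => h2 v τ⟩

end
end

section
/- Let c ∈ ℂ. The function g_{1,4}(τ) − c has neither zeros nor poles on the upper half-plane ℍ if and only if c ∈ {0, 16}. -/
noncomputable section

open Complex Matrix UpperHalfPlane MatrixGroups

/-- The function `g_{1,4}(τ) = (g_{(1/2,0)}(4τ)/g_{(1/4,0)}(4τ))⁸`. -/
def g14 (τ : ℍ) : ℂ := (siegel (1 / 2, 0) (fourH τ) / siegel (1 / 4, 0) (fourH τ)) ^ 8

namespace G14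

open ModularForm Function Filter Topology

/-- Euler product. -/
def EE (x : ℂ) : ℂ := ∏' n : ℕ, (1 - x ^ (n + 1))

/-- Odd part of the Euler product. -/
def OO (x : ℂ) : ℂ := ∏' n : ℕ, (1 - x ^ (2 * n + 1))

lemma mult_aux {x : ℂ} (hx : ‖x‖ < 1) (e : ℕ → ℕ) (he : Injective e) :
    Multipliable fun n : ℕ ↦ 1 - x ^ (e n) := by
  simp_rw [sub_eq_add_neg]
  apply multipliable_one_add_of_summable (f := fun n ↦ -x ^ (e n))
  simpa [Function.comp_def] using
    (summable_geometric_of_lt_one (norm_nonneg _) hx).comp_injective he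

lemma norm_pow_lt {x : ℂ} (hx : ‖x‖ < 1) {n : ℕ} (hn : n ≠ 0) : ‖x ^ n‖ < 1 := by
  rw [norm_pow]; exact pow_lt_one₀ (norm_nonneg _) hx hn

lemma EE_ne {x : ℂ} (hx : ‖x‖ < 1) : EE x ≠ 0 := by
  unfold EE
  simp_rw [sub_eq_add_neg]
  refine tprod_one_add_ne_zero_of_summable (f := fun n ↦ -x ^ (n + 1)) ?_ ?_
  · intro i h
    have h1 : x ^ (i + 1) = 1 := by linear_combination -h
    have := norm_pow_lt hx (Nat.succ_ne_zero i)
    rw [Nat.succ_eq_add_one, h1] at this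
    simp at this
  · simpa using (summable_nat_add_iff 1).mpr (summable_geometric_of_lt_one (norm_nonneg _) hx)

lemma OO_mul_neg {x : ℂ} (hx : ‖x‖ < 1) : OO x * OO (-x) = OO (x ^ 2) := by
  unfold OO
  rw [← Multipliable.tprod_mul (mult_aux hx _ (fun a b h ↦ by simpa using h))
    (mult_aux (by simpa using hx) _ (fun a b h ↦ by simpa using h))]
  congr 1; ext n
  rw [Odd.neg_pow ⟨n, rfl⟩, ← pow_mul]; ring

lemma EE_split {x : ℂ} (hx : ‖x‖ < 1) : EE x = OO x * EE (x ^ 2) := by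
  unfold EE OO
  rw [← tprod_even_mul_odd (f := fun n ↦ 1 - x ^ (n + 1))
    (mult_aux hx (fun n ↦ 2 * n + 1) (fun a b h ↦ by simpa using h))
    (mult_aux hx (fun n ↦ 2 * n + 1 + 1) (fun a b h ↦ by simpa using h))]
  congr 2; ext n
  rw [← pow_mul]; ring

lemma OO_ne {x : ℂ} (hx : ‖x‖ < 1) : OO x ≠ 0 := by
  have := EE_ne hx
  rw [EE_split hx] at this
  exact left_ne_zero_of_mul this

lemma EE_prod {x : ℂ} (hx : ‖x‖ < 1) : EE (-x) * EE x * EE (x ^ 4) = EE (x ^ 2) ^ 3 := by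
  have h1 := EE_split hx
  have h2 := EE_split (x := -x) (by simpa using hx)
  have h3 := EE_split (norm_pow_lt hx two_ne_zero)
  have h4 := OO_mul_neg hx
  rw [neg_sq] at h2
  rw [← pow_mul] at h3
  norm_num at h3
  rw [h1, h2]
  linear_combination (EE (x^2))^2 * EE (x^4) * h4 - EE (x^2)^2 * h3

lemma EE_diff : DifferentiableOn ℂ EE (Metric.ball (0 : ℂ) 1) :=
  differentiableOn_tprod_one_sub_pow

lemma EE_zero : EE 0 = 1 := by simp [EE]

/-- nome -/
def nm (z : ℂ) : ℂ := Complex.exp (Real.pi * Complex.I * z)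

/-- third root of the nome -/
def rr (z : ℂ) : ℂ := Complex.exp (Real.pi * Complex.I * z / 3)

lemma nm_eq (z : ℂ) : nm z = Periodic.qParam 2 z := by
  unfold nm Periodic.qParam; congr 1; push_cast; ring

lemma nm_norm {z : ℂ} (hz : 0 < z.im) : ‖nm z‖ < 1 := by
  rw [nm_eq]; exact Periodic.norm_qParam_lt_one two_pos hz

lemma nm_ne (z : ℂ) : nm z ≠ 0 := Complex.exp_ne_zero _
lemma rr_ne (z : ℂ) : rr z ≠ 0 := Complex.exp_ne_zero _
lemma rr_cube (z : ℂ) : rr z ^ 3 = nm z := by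
  unfold rr nm; rw [← Complex.exp_nat_mul]; congr 1; push_cast; ring

lemma nm_tendsto : Tendsto (fun τ : ℍ ↦ nm τ) atImInfty (𝓝 0) := by
  simp_rw [nm_eq]
  exact UpperHalfPlane.qParam_tendsto_atImInfty two_pos

lemma nm_add_one (z : ℂ) : nm (z + 1) = - nm z := by
  unfold nm
  rw [mul_add, Complex.exp_add, mul_one, Complex.exp_pi_mul_I]; ring

lemma nm_diff : Differentiable ℂ nm := by unfold nm; fun_prop

lemma eta_eq (z : ℂ) : ModularForm.eta z = Complex.exp (Real.pi * Complex.I * z / 12) * EE (nm z ^ 2) := by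
  unfold ModularForm.eta EE eta_q
  have h1 : Periodic.qParam 24 z = Complex.exp (Real.pi * Complex.I * z / 12) := by
    unfold Periodic.qParam; congr 1; push_cast; ring
  have h2 : Periodic.qParam 1 z = nm z ^ 2 := by
    unfold Periodic.qParam nm; rw [← Complex.exp_nat_mul]; congr 1; push_cast; ring
  rw [h1, h2]

lemma eta_S {z : ℂ} (hz : 0 < z.im) : ModularForm.eta (-1 / z) ^ 8 = z ^ 4 * ModularForm.eta z ^ 8 := by
  have h := eta_comp_eq_csqrt_I_inv (show z ∈ upperHalfPlaneSet from hz)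
  simp only [Function.comp_apply, Pi.smul_apply, Pi.mul_apply, smul_eq_mul] at h
  have hs : ∀ w : ℂ, w ≠ 0 → sqrt w ^ 8 = w ^ 4 := by
    intro w hw
    have : sqrt w ^ 2 = w := by
      rw [sqrt_eq_exp hw, ← Complex.exp_nat_mul]; push_cast; rw [show 2 * (Complex.log w / 2) = Complex.log w by ring, Complex.exp_log hw]
    rw [show (8 : ℕ) = 2 * 4 by norm_num, pow_mul, this]
  have hz0 : z ≠ 0 := by rintro rfl; simp at hz
  rw [h, mul_pow, mul_pow, inv_pow, hs _ hz0, hs _ Complex.I_ne_zero, Complex.I_pow_four]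
  simp

lemma eta_half (z : ℂ) : ModularForm.eta (z / 2) ^ 8 = rr z * EE (nm z) ^ 8 := by
  have h : nm (z / 2) ^ 2 = nm z := by
    unfold nm; rw [← Complex.exp_nat_mul]; congr 1; push_cast; ring
  rw [eta_eq, mul_pow, ← Complex.exp_nat_mul, h]
  unfold rr
  congr 2
  push_cast; ring

lemma eta_two (z : ℂ) : ModularForm.eta (2 * z) ^ 8 = rr z * nm z * EE (nm z ^ 4) ^ 8 := by
  rw [eta_eq, mul_pow, ← Complex.exp_nat_mul]
  congr 3
  · unfold rr nm; rw [← Complex.exp_add]; congr 1; push_cast; ring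
  · unfold nm; rw [← Complex.exp_nat_mul, ← Complex.exp_nat_mul]; congr 1; push_cast; ring

lemma eta_24 (z : ℂ) : (ModularForm.eta z ^ 8) ^ 3 = nm z ^ 2 * EE (nm z ^ 2) ^ 24 := by
  rw [eta_eq, ← pow_mul, mul_pow, ← Complex.exp_nat_mul]
  congr 2
  · unfold nm; rw [← Complex.exp_nat_mul]; congr 1; push_cast; ring

lemma im_S {z : ℂ} (hz : 0 < z.im) : 0 < (-1 / z).im := by
  have := UpperHalfPlane.im_inv_neg_coe_pos ⟨z, hz⟩
  have e : -1 / z = (-z)⁻¹ := by rw [inv_neg]; ring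
  rw [e]; exact this

lemma S1 {z : ℂ} (hz : 0 < z.im) : rr (-1 / z) * EE (nm (-1 / z)) ^ 8 =
    z ^ 4 * (16 * rr z * nm z * EE (nm z ^ 4) ^ 8) := by
  have hz0 : z ≠ 0 := by rintro rfl; simp at hz
  rw [← eta_half, show -1 / z / 2 = -1 / (2 * z) by field_simp, eta_S (by simpa using hz), eta_two]
  ring

lemma S2 {z : ℂ} (hz : 0 < z.im) : 16 * rr (-1 / z) * nm (-1 / z) * EE (nm (-1 / z) ^ 4) ^ 8 =
    z ^ 4 * (rr z * EE (nm z) ^ 8) := by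
  have hz0 : z ≠ 0 := by rintro rfl; simp at hz
  have h := eta_two (-1 / z)
  rw [show 2 * (-1 / z) = -1 / (z / 2) by field_simp, eta_S (by simpa using hz), eta_half] at h
  linear_combination -16 * h

lemma S3 {z : ℂ} (hz : 0 < z.im) : nm (-1 / z) ^ 2 * EE (nm (-1 / z) ^ 2) ^ 24 =
    z ^ 12 * (nm z ^ 2 * EE (nm z ^ 2) ^ 24) := by
  rw [← eta_24, eta_S hz, ← eta_24]; ring

lemma Zid {z : ℂ} (hz : 0 < z.im) : (rr z * EE (-nm z) ^ 8) * (rr z * EE (nm z) ^ 8) *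
    (16 * rr z * nm z * EE (nm z ^ 4) ^ 8) = 16 * (nm z ^ 2 * EE (nm z ^ 2) ^ 24) := by
  have h := EE_prod (nm_norm hz)
  have h3 := rr_cube z
  calc _ = 16 * rr z ^ 3 * nm z * (EE (-nm z) * EE (nm z) * EE (nm z ^ 4)) ^ 8 := by ring
    _ = _ := by rw [h, h3]; ring

lemma S4 {z : ℂ} (hz : 0 < z.im) : rr (-1 / z) * EE (-nm (-1 / z)) ^ 8 =
    z ^ 4 * (rr z * EE (-nm z) ^ 8) := by
  have h0 := Zid hz
  have h1 := Zid (im_S hz)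
  rw [S1 hz, S2 hz, S3 hz] at h1
  have hz0 : z ≠ 0 := by rintro rfl; simp at hz
  have hA : z ^ 8 * (rr z * EE (nm z) ^ 8) * (16 * rr z * nm z * EE (nm z ^ 4) ^ 8) ≠ 0 := by
    have := EE_ne (nm_norm hz)
    have := EE_ne (norm_pow_lt (nm_norm hz) four_ne_zero)
    have := rr_ne z
    have := nm_ne z
    simp [*]
  apply mul_right_cancel₀ hA
  linear_combination h1 - z ^ 12 * h0

theorem weight_zero {f : ℂ → ℂ} (hd : DifferentiableOn ℂ f upperHalfPlaneSet)
    (hT : ∀ z : ℂ, 0 < z.im → f (z + 1) = f z) (hS : ∀ z : ℂ, 0 < z.im → f (-1 / z) = f z)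
    (h0 : Tendsto (fun τ : ℍ ↦ f τ) atImInfty (𝓝 0)) (z : ℂ) (hz : 0 < z.im) : f z = 0 := by
  have hS' : (fun τ : ℍ ↦ f τ) ∣[(0 : ℤ)] ModularGroup.S = fun τ : ℍ ↦ f τ := by
    ext τ
    rw [SL_slash_apply, UpperHalfPlane.modular_S_smul]
    simpa [neg_div] using hS τ τ.2
  have hT' : (fun τ : ℍ ↦ f τ) ∣[(0 : ℤ)] ModularGroup.T = fun τ : ℍ ↦ f τ := by
    ext τ
    rw [SL_slash_apply, UpperHalfPlane.modular_T_smul]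
    simpa [add_comm] using hT τ τ.2
  let F : CuspForm 𝒮ℒ 0 :=
    { toFun := fun τ : ℍ ↦ f τ
      slash_action_eq' := by
        intro A hA
        obtain ⟨A, rfl⟩ := hA
        exact SlashInvariantForm.slash_action_generators_SL2Z hS' hT' A
      holo' := by
        rw [UpperHalfPlane.mdifferentiable_iff]
        refine hd.congr fun z hz ↦ ?_
        simp [ofComplex_apply_of_im_pos hz]
      zero_at_cusps' := by
        intro c hc
        rw [Subgroup.IsArithmetic.isCusp_iff_isCusp_SL2Z] at hc
        rw [OnePoint.isZeroAt_iff_forall_SL2Z hc]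
        intro γ _
        rw [SlashInvariantForm.slash_action_generators_SL2Z hS' hT']
        exact h0 }
  obtain ⟨c, hc⟩ := ModularFormClass.levelOne_weight_zero_const F
  have hc' : ∀ τ : ℍ, f τ = c := fun τ ↦ congrFun hc τ
  have : c = 0 := by
    simp_rw [hc'] at h0
    exact tendsto_nhds_unique tendsto_const_nhds h0
  rw [← this]; exact hc' ⟨z, hz⟩

/-- The Jacobi defect. -/
def HH (x : ℂ) : ℂ := EE (-x) ^ 8 - EE x ^ 8 - 16 * x * EE (x ^ 4) ^ 8

lemma EE_diffAt {x : ℂ} (hx : ‖x‖ < 1) : DifferentiableAt ℂ EE x :=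
  EE_diff.differentiableAt (Metric.isOpen_ball.mem_nhds (by simpa using hx))

lemma EE_neg_diffAt {x : ℂ} (hx : ‖x‖ < 1) : DifferentiableAt ℂ (fun x ↦ EE (-x)) x :=
  DifferentiableAt.comp (f := fun x ↦ -x) x (EE_diffAt (by simpa using hx)) (by fun_prop)

lemma EE_pow_diffAt {x : ℂ} (hx : ‖x‖ < 1) {n : ℕ} (hn : n ≠ 0) :
    DifferentiableAt ℂ (fun x ↦ EE (x ^ n)) x :=
  DifferentiableAt.comp (f := fun x ↦ x ^ n) x (EE_diffAt (norm_pow_lt hx hn)) (by fun_prop)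

lemma HH_diffAt {x : ℂ} (hx : ‖x‖ < 1) : DifferentiableAt ℂ HH x := by
  have h1 := EE_diffAt hx
  have h2 := EE_neg_diffAt hx
  have h3 := EE_pow_diffAt hx four_ne_zero
  unfold HH
  fun_prop

lemma HH_neg (x : ℂ) : HH (-x) = - HH x := by
  unfold HH
  rw [neg_neg, Even.neg_pow (by decide : Even 4)]; ring

theorem HH_zero {z : ℂ} (hz : 0 < z.im) : HH (nm z) = 0 := by
  have key := weight_zero (f := fun z ↦ HH (nm z) ^ 3 / (nm z * EE (nm z ^ 2) ^ 24))
    ?_ ?_ ?_ ?_ z hz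
  · have h1 := EE_ne (norm_pow_lt (nm_norm hz) two_ne_zero)
    have h2 := nm_ne z
    simpa [h1, h2] using key
  · intro w hw
    have hx := nm_norm (show 0 < w.im from hw)
    have h1 : DifferentiableAt ℂ (fun w ↦ HH (nm w)) w :=
      DifferentiableAt.comp w (HH_diffAt hx) nm_diff.differentiableAt
    have h2 : DifferentiableAt ℂ (fun w ↦ EE (nm w ^ 2)) w :=
      DifferentiableAt.comp w (EE_pow_diffAt hx two_ne_zero) nm_diff.differentiableAt
    have h3 : DifferentiableAt ℂ nm w := nm_diff.differentiableAt
    have h4 := EE_ne (norm_pow_lt hx two_ne_zero)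
    exact ((h1.fun_pow 3).fun_div (h3.fun_mul (h2.fun_pow 24))
      (mul_ne_zero (nm_ne w) (pow_ne_zero _ h4))).differentiableWithinAt
  · intro w hw
    simp only [nm_add_one, HH_neg, neg_sq, neg_mul, Odd.neg_pow (by decide : Odd 3), neg_div_neg_eq]
  · intro w hw
    have hx := nm_norm hw
    have hx' := nm_norm (im_S hw)
    have a1 := EE_ne (norm_pow_lt hx two_ne_zero)
    have a2 := EE_ne (norm_pow_lt hx' two_ne_zero)
    have a3 := nm_ne w
    have a4 := nm_ne (-1 / w)
    have hH : rr (-1 / w) * HH (nm (-1 / w)) = w ^ 4 * (rr w * HH (nm w)) := by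
      unfold HH
      linear_combination S4 hw - S1 hw - S2 hw
    have hH3 : nm (-1 / w) * HH (nm (-1 / w)) ^ 3 = w ^ 12 * (nm w * HH (nm w) ^ 3) := by
      have := congrArg (· ^ 3) hH
      simp only [mul_pow, rr_cube] at this
      rw [this]; ring
    have h3 := S3 hw
    have hw0 : w ≠ 0 := by rintro rfl; simp at hw
    rw [div_eq_div_iff (by simp [*]) (by simp [*])]
    have : w ^ 12 * nm w * nm (-1 / w) ≠ 0 := by simp [*]
    apply mul_left_cancel₀ this
    linear_combination w ^ 12 * nm w ^ 2 * EE (nm w ^ 2) ^ 24 * hH3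
      - w ^ 12 * nm w * HH (nm w) ^ 3 * h3
  · have hc : ContinuousAt (fun x ↦ (dslope HH 0 x) ^ 3 * x ^ 2 / EE (x ^ 2) ^ 24) 0 := by
      have h1 : ContinuousAt (dslope HH 0) 0 := continuousAt_dslope_same.2 (HH_diffAt (by simp))
      have h2 := (EE_pow_diffAt (x := 0) (by simp) two_ne_zero).continuousAt
      exact ContinuousAt.div₀ (f := fun x ↦ (dslope HH 0 x) ^ 3 * x ^ 2)
        ((h1.fun_pow 3).mul (g := fun x : ℂ ↦ x ^ 2) (by fun_prop)) (h2.fun_pow 24) (by simp [EE_zero])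
    have ht := hc.tendsto.comp nm_tendsto
    simp only [ne_eq, OfNat.ofNat_ne_zero, not_false_eq_true, zero_pow, mul_zero, zero_div] at ht
    refine ht.congr fun τ ↦ ?_
    have h1 := EE_ne (norm_pow_lt (nm_norm τ.2) two_ne_zero)
    have h2 := nm_ne τ
    have h0 : HH 0 = 0 := by simp [HH]
    simp only [Function.comp_apply]
    rw [dslope_of_ne _ h2, slope_def_field, h0]
    change EE (nm (τ : ℂ) ^ 2) ≠ 0 at h1
    field_simp
    simp

/-- The modular lambda function. -/
def lam (z : ℂ) : ℂ := 16 * nm z * EE (nm z ^ 4) ^ 8 / EE (-nm z) ^ 8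

lemma EE_neg_ne {x : ℂ} (hx : ‖x‖ < 1) : EE (-x) ≠ 0 := EE_ne (by simpa using hx)

lemma one_sub_lam {z : ℂ} (hz : 0 < z.im) : 1 - lam z = EE (nm z) ^ 8 / EE (-nm z) ^ 8 := by
  have h := HH_zero hz
  have h1 := EE_neg_ne (nm_norm hz)
  unfold HH at h
  unfold lam
  field_simp
  linear_combination h

lemma lam_ne_zero {z : ℂ} (hz : 0 < z.im) : lam z ≠ 0 := by
  have h1 := EE_neg_ne (nm_norm hz)
  have h2 := EE_ne (norm_pow_lt (nm_norm hz) four_ne_zero)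
  have h3 := nm_ne z
  unfold lam
  simp [*]

lemma one_sub_lam_ne_zero {z : ℂ} (hz : 0 < z.im) : 1 - lam z ≠ 0 := by
  rw [one_sub_lam hz]
  have h1 := EE_neg_ne (nm_norm hz)
  have h2 := EE_ne (nm_norm hz)
  simp [*]

lemma lam_T {z : ℂ} (hz : 0 < z.im) : lam (z + 1) = lam z / (lam z - 1) := by
  have h : lam z - 1 = - (EE (nm z) ^ 8 / EE (-nm z) ^ 8) := by rw [← one_sub_lam hz]; ring
  rw [h]
  unfold lam
  rw [nm_add_one, neg_neg, Even.neg_pow (by decide : Even 4)]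
  have h1 := EE_neg_ne (nm_norm hz)
  have h2 := EE_ne (nm_norm hz)
  field_simp

lemma lam_S {z : ℂ} (hz : 0 < z.im) : lam (-1 / z) = 1 - lam z := by
  rw [one_sub_lam hz]
  have h1 := EE_neg_ne (nm_norm hz)
  have h1' := EE_neg_ne (nm_norm (im_S hz))
  have hr := rr_ne z
  have hr' := rr_ne (-1 / z)
  have hz0 : z ≠ 0 := by rintro rfl; simp at hz
  unfold lam
  rw [div_eq_div_iff (by simp [*]) (by simp [*])]
  have : z ^ 4 * rr z * rr (-1 / z) ≠ 0 := by simp [*]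
  apply mul_left_cancel₀ this
  linear_combination z ^ 4 * rr z * EE (-nm z) ^ 8 * S2 hz - z ^ 4 * rr z * EE (nm z) ^ 8 * S4 hz

lemma lam_tendsto : Tendsto (fun τ : ℍ ↦ lam τ) atImInfty (𝓝 0) := by
  have h2 := (EE_pow_diffAt (x := 0) (by simp) four_ne_zero).continuousAt
  have h3 := (EE_neg_diffAt (x := 0) (by simp)).continuousAt
  have hc : ContinuousAt (fun x ↦ 16 * x * EE (x ^ 4) ^ 8 / EE (-x) ^ 8) 0 := by
    refine ContinuousAt.div₀ ?_ (h3.fun_pow 8) (by simp [EE_zero])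
    exact ContinuousAt.mul (f := fun x : ℂ ↦ 16 * x) (by fun_prop) (h2.fun_pow 8)
  have ht := hc.tendsto.comp nm_tendsto
  simpa [Function.comp_def, lam] using ht

lemma lam_diffAt {z : ℂ} (hz : 0 < z.im) : DifferentiableAt ℂ lam z := by
  have hx := nm_norm hz
  have h1 : DifferentiableAt ℂ (fun w ↦ EE (-nm w)) z :=
    DifferentiableAt.comp z (EE_neg_diffAt hx) nm_diff.differentiableAt
  have h2 : DifferentiableAt ℂ (fun w ↦ EE (nm w ^ 4)) z :=
    DifferentiableAt.comp z (EE_pow_diffAt hx four_ne_zero) nm_diff.differentiableAt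
  have h3 : DifferentiableAt ℂ nm z := nm_diff.differentiableAt
  exact (((h3.const_mul 16).fun_mul (h2.fun_pow 8)).fun_div (h1.fun_pow 8)
    (pow_ne_zero _ (EE_neg_ne hx)))

lemma j_surj (d : ℂ) : ∃ z : ℂ, 0 < z.im ∧
    (1 - lam z + lam z ^ 2) ^ 3 = d * (lam z ^ 2 * (1 - lam z) ^ 2) := by
  by_contra! hcon
  have hne : ∀ z : ℂ, 0 < z.im →
      (1 - lam z + lam z ^ 2) ^ 3 - d * (lam z ^ 2 * (1 - lam z) ^ 2) ≠ 0 :=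
    fun z hz ↦ sub_ne_zero.2 (hcon z hz)
  have key := weight_zero (f := fun z ↦ lam z ^ 2 * (1 - lam z) ^ 2 /
    ((1 - lam z + lam z ^ 2) ^ 3 - d * (lam z ^ 2 * (1 - lam z) ^ 2))) ?_ ?_ ?_ ?_
    Complex.I (by simp)
  · have h1 := lam_ne_zero (z := Complex.I) (by simp)
    have h2 := one_sub_lam_ne_zero (z := Complex.I) (by simp)
    have h3 := hne Complex.I (by simp)
    simp [h1, h2, h3] at key
  · intro w hw
    have := lam_diffAt (show 0 < w.im from hw)
    have h := hne w hw
    exact (DifferentiableAt.fun_div (c := fun z ↦ lam z ^ 2 * (1 - lam z) ^ 2)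
      (d := fun z ↦ (1 - lam z + lam z ^ 2) ^ 3 - d * (lam z ^ 2 * (1 - lam z) ^ 2))
      (by fun_prop) (by fun_prop) h).differentiableWithinAt
  · intro z hz
    have h := hne z hz
    have h' := hne (z + 1) (by simpa using hz)
    have h1 : lam z - 1 ≠ 0 := by
      have := one_sub_lam_ne_zero hz
      intro h; apply this; linear_combination -h
    rw [div_eq_div_iff h' h, lam_T hz]
    field_simp
    ring
  · intro z hz
    rw [lam_S hz]
    congr 1 <;> ring
  · have hc : ContinuousAt (fun l : ℂ ↦ l ^ 2 * (1 - l) ^ 2 /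
      ((1 - l + l ^ 2) ^ 3 - d * (l ^ 2 * (1 - l) ^ 2))) 0 :=
      ContinuousAt.div₀ (by fun_prop) (by fun_prop) (by simp)
    have ht := hc.tendsto.comp lam_tendsto
    simpa [Function.comp_def] using ht

/-- `l` is a value of `lam`. -/
def Val (l : ℂ) : Prop := ∃ z : ℂ, 0 < z.im ∧ lam z = l

lemma Val.S {l : ℂ} (h : Val l) : Val (1 - l) := by
  obtain ⟨z, hz, rfl⟩ := h
  exact ⟨-1 / z, im_S hz, lam_S hz⟩

lemma Val.T {l : ℂ} (h : Val l) : Val (l / (l - 1)) := by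
  obtain ⟨z, hz, rfl⟩ := h
  exact ⟨z + 1, by simpa using hz, lam_T hz⟩

lemma Val.eq {l m : ℂ} (h : Val l) (e : l = m) : Val m := e ▸ h

lemma val_all {l : ℂ} (h0 : l ≠ 0) (h1 : 1 - l ≠ 0) : Val l := by
  obtain ⟨z, hz, h⟩ := j_surj ((1 - l + l ^ 2) ^ 3 / (l ^ 2 * (1 - l) ^ 2))
  have ha0 := lam_ne_zero hz
  have ha1 := one_sub_lam_ne_zero hz
  have hv : Val (lam z) := ⟨z, hz, rfl⟩
  generalize lam z = a at *
  have h1' : l - 1 ≠ 0 := fun h ↦ h1 (by linear_combination -h)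
  have ha1' : a - 1 ≠ 0 := fun h ↦ ha1 (by linear_combination -h)
  field_simp at h
  have hf : (a - l) * (a - (1 - l)) * (a * l - 1) * (a * (1 - l) - 1) * (a * l - (l - 1)) *
      (a * (l - 1) - l) = 0 := by
    linear_combination -h
  simp only [mul_eq_zero, sub_eq_zero] at hf
  obtain ((((hf | hf) | hf) | hf) | hf) | hf := hf
  · exact hv.eq hf
  · exact hv.S.eq (by rw [hf]; ring)
  · have e : a = 1 / l := by field_simp; exact hf
    refine hv.S.T.S.eq ?_
    have e2 : 1 - a - 1 ≠ 0 := by simpa using ha0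
    have : a * l = 1 := hf
    field_simp
    linear_combination this
  · refine hv.S.T.eq ?_
    have e2 : 1 - a - 1 ≠ 0 := by simpa using ha0
    field_simp
    linear_combination -hf
  · refine hv.T.S.eq ?_
    field_simp
    linear_combination -hf
  · refine hv.T.eq ?_
    field_simp
    linear_combination -hf

lemma qpow_four (τ : ℍ) (y : ℂ) (m : ℕ) (hy : 4 * y = m) :
    qpow (fourH τ) y = nm (2 * τ) ^ m := by
  have h4 : ((fourH τ : ℍ) : ℂ) = 4 * (τ : ℂ) := rfl
  unfold qpow nm
  rw [← Complex.exp_nat_mul, h4, ← hy]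
  congr 1; ring

lemma im_two (τ : ℍ) : 0 < (2 * (τ : ℂ)).im := by simpa using τ.2

lemma siegel_half (τ : ℍ) : siegel (1 / 2, 0) (fourH τ) =
    - Complex.exp (-(Real.pi * Complex.I * τ / 3)) * OO (nm (2 * τ) ^ 2) ^ 2 := by
  have hx := nm_norm (im_two τ)
  have h4 : ((fourH τ : ℍ) : ℂ) = 4 * (τ : ℂ) := rfl
  have hB : qpow (fourH τ) ((((1 / 2 : ℚ) : ℂ) ^ 2 - ((1 / 2 : ℚ) : ℂ) + 1 / 6) / 2) =
      Complex.exp (-(Real.pi * Complex.I * τ / 3)) := by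
    unfold qpow; rw [h4]; congr 1; push_cast; ring
  have hF : qpow (fourH τ) ((1 / 2 : ℚ) : ℂ) = nm (2 * τ) ^ 2 :=
    qpow_four τ _ 2 (by push_cast; ring)
  have hp : ∀ n : ℕ, qpow (fourH τ) ((n : ℂ) + 1 + ((1 / 2 : ℚ) : ℂ)) =
      nm (2 * τ) ^ (2 * (2 * (n + 1) + 1)) :=
    fun n ↦ qpow_four τ _ _ (by push_cast; ring)
  have hm : ∀ n : ℕ, qpow (fourH τ) ((n : ℂ) + 1 - ((1 / 2 : ℚ) : ℂ)) =
      nm (2 * τ) ^ (2 * (2 * n + 1)) :=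
    fun n ↦ qpow_four τ _ _ (by push_cast; ring)
  unfold siegel
  simp only [hB, hF, hp, hm, e2pi]
  simp only [Rat.cast_zero, neg_zero, mul_zero, zero_mul, Complex.exp_zero, mul_one, neg_one_mul]
  generalize nm (2 * τ) = x at *
  have hO : OO (x ^ 2) = ∏' n : ℕ, (1 - x ^ (2 * (2 * n + 1))) := by
    unfold OO; simp_rw [pow_mul]
  have hM := mult_aux hx (fun n ↦ 2 * (2 * n + 1)) (fun a b h ↦ by simpa using h)
  have hM' := mult_aux hx (fun n ↦ 2 * (2 * (n + 1) + 1)) (fun a b h ↦ by simpa using h)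
  have hO' : OO (x ^ 2) = (1 - x ^ 2) * ∏' n : ℕ, (1 - x ^ (2 * (2 * (n + 1) + 1))) := by
    rw [hO, tprod_eq_zero_mul' (f := fun n ↦ 1 - x ^ (2 * (2 * n + 1))) hM']
  rw [hM'.tprod_mul hM, ← hO, sq (OO (x ^ 2))]
  nth_rewrite 2 [hO']
  ring

lemma siegel_quarter (τ : ℍ) : siegel (1 / 4, 0) (fourH τ) =
    - Complex.exp (-(Real.pi * Complex.I * τ / 12)) * OO (nm (2 * τ)) := by
  have hx := nm_norm (im_two τ)
  have h4 : ((fourH τ : ℍ) : ℂ) = 4 * (τ : ℂ) := rfl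
  have hB : qpow (fourH τ) ((((1 / 4 : ℚ) : ℂ) ^ 2 - ((1 / 4 : ℚ) : ℂ) + 1 / 6) / 2) =
      Complex.exp (-(Real.pi * Complex.I * τ / 12)) := by
    unfold qpow; rw [h4]; congr 1; push_cast; ring
  have hF : qpow (fourH τ) ((1 / 4 : ℚ) : ℂ) = nm (2 * τ) ^ 1 :=
    qpow_four τ _ 1 (by push_cast; ring)
  have hp : ∀ n : ℕ, qpow (fourH τ) ((n : ℂ) + 1 + ((1 / 4 : ℚ) : ℂ)) =
      nm (2 * τ) ^ (2 * (2 * (n + 1)) + 1) :=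
    fun n ↦ qpow_four τ _ _ (by push_cast; ring)
  have hm : ∀ n : ℕ, qpow (fourH τ) ((n : ℂ) + 1 - ((1 / 4 : ℚ) : ℂ)) =
      nm (2 * τ) ^ (2 * (2 * n + 1) + 1) :=
    fun n ↦ qpow_four τ _ _ (by push_cast; ring)
  unfold siegel
  simp only [hB, hF, hp, hm, e2pi]
  simp only [Rat.cast_zero, neg_zero, mul_zero, zero_mul, Complex.exp_zero, mul_one, neg_one_mul]
  generalize nm (2 * τ) = x at *
  have hM0 := mult_aux hx (fun n ↦ 2 * (2 * n) + 1) (fun a b h ↦ by simpa using h)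
  have hM := mult_aux hx (fun n ↦ 2 * (2 * n + 1) + 1) (fun a b h ↦ by simpa using h)
  have hM' := mult_aux hx (fun n ↦ 2 * (2 * (n + 1)) + 1) (fun a b h ↦ by simpa using h)
  have hO : OO x = (∏' n : ℕ, (1 - x ^ (2 * (2 * n) + 1))) *
      ∏' n : ℕ, (1 - x ^ (2 * (2 * n + 1) + 1)) :=
    (tprod_even_mul_odd (f := fun n ↦ 1 - x ^ (2 * n + 1)) hM0 hM).symm
  have hO' : ∏' n : ℕ, (1 - x ^ (2 * (2 * n) + 1)) =
      (1 - x ^ 1) * ∏' n : ℕ, (1 - x ^ (2 * (2 * (n + 1)) + 1)) := by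
    rw [tprod_eq_zero_mul' (f := fun n ↦ 1 - x ^ (2 * (2 * n) + 1)) hM']
  rw [hM'.tprod_mul hM, hO, hO']
  ring

lemma g14_eq (τ : ℍ) : g14 τ = 16 / lam (2 * τ) := by
  unfold g14
  rw [siegel_half, siegel_quarter]
  have hx := nm_norm (im_two τ)
  have hx2 := norm_pow_lt hx two_ne_zero
  unfold lam
  have e1 : Complex.exp (-(Real.pi * Complex.I * τ / 3)) =
      Complex.exp (-(Real.pi * Complex.I * τ / 12)) *
      Complex.exp (-(Real.pi * Complex.I * τ / 4)) := by
    rw [← Complex.exp_add]; congr 1; ring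
  have e2 : Complex.exp (-(Real.pi * Complex.I * τ / 4)) ^ 8 * nm (2 * τ) = 1 := by
    unfold nm
    rw [← Complex.exp_nat_mul, ← Complex.exp_add, ← Complex.exp_zero]; congr 1; push_cast; ring
  have e3 := Complex.exp_ne_zero (-(Real.pi * Complex.I * τ / 12))
  rw [e1]
  have hn := nm_ne (2 * τ)
  generalize nm (2 * τ) = x at *
  generalize Complex.exp (-(Real.pi * Complex.I * τ / 12)) = A at *
  generalize Complex.exp (-(Real.pi * Complex.I * τ / 4)) = B at *
  have h1 := EE_split (x := -x) (by simpa using hx)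
  rw [neg_sq] at h1
  have h2 := EE_split hx2
  rw [← pow_mul] at h2
  norm_num at h2
  have h3 := OO_mul_neg hx
  have n1 := OO_ne hx
  have n2 := OO_ne (x := -x) (by simpa using hx)
  have n4 := EE_ne (norm_pow_lt hx four_ne_zero)
  have hB : B ^ 8 = 1 / x := by field_simp; exact e2
  have r1 : -(A * B) * OO (x ^ 2) ^ 2 / (-A * OO x) = B * (OO (x ^ 2) * OO (-x)) := by
    rw [← h3]; field_simp
  have r2 : EE (-x) = OO (-x) * (OO (x ^ 2) * EE (x ^ 4)) := by rw [h1, h2]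
  have n5 := OO_ne hx2
  rw [r1, r2, mul_pow, hB]
  field_simp

end G14

/-- For `c ∈ ℂ`, the function `g_{1,4} - c` has neither zeros nor poles
on `ℍ` (it is holomorphic on `ℍ`, so this means it is nonvanishing) iff `c ∈ {0, 16}`. -/
theorem g14_sub_ne_zero_iff (c : ℂ) :
    (∀ τ : ℍ, g14 τ - c ≠ 0) ↔ c = 0 ∨ c = 16 := by
  simp only [G14.g14_eq]
  constructor
  · intro h
    by_contra! hc
    obtain ⟨h0, h16⟩ := hc
    have h1 : 1 - 16 / c ≠ 0 := by
      intro h; apply h16; field_simp at h; linear_combination h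
    obtain ⟨z, hz, hl⟩ := G14.val_all (l := 16 / c) (by simp [h0]) h1
    have hz2 : 0 < (z / 2).im := by simpa using hz
    apply h ⟨z / 2, hz2⟩
    change 16 / G14.lam (2 * (z / 2)) - c = 0
    rw [mul_div_cancel₀ _ two_ne_zero, hl]
    field_simp
    simp
  · rintro (rfl | rfl) τ
    · have := G14.lam_ne_zero (G14.im_two τ)
      simp [this]
    · have h1 := G14.lam_ne_zero (G14.im_two τ)
      have h2 := G14.one_sub_lam_ne_zero (G14.im_two τ)
      intro h
      apply h2
      field_simp at h
      linear_combination h / 16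

end
end
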